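/- arXiv:1601.08229 — 2 statements merged into one kernel-verified Lean document; each statement's English description precedes it below -/
import Mathlib

section
/- For n ≥ 2, the border rank of the n×n matrix multiplication tensor M_⟨n⟩ satisfies R̲(M_⟨n⟩) ≥ 2n² − n + 1. -/
open scoped BigOperators

/-- A tensor `T`, given by its coordinate array, has rank at most `r`. -/
def tensorRankLE {ιa ιb ιc : Type*} (r : ℕ) (T : ιa → ιb → ιc → ℂ) : Prop :=
  ∃ (u : Fin r → ιa → ℂ) (v : Fin r → ιb → ℂ) (w : Fin r → ιc → ℂ),
    ∀ i j k, T i j k = ∑ l, u l i * v l j * w l k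

/-- `T` has border rank at most `r`. -/
def borderRankLE {ιa ιb ιc : Type*} (r : ℕ) (T : ιa → ιb → ιc → ℂ) : Prop :=
  T ∈ closure {S : ιa → ιb → ιc → ℂ | tensorRankLE r S}

/-- The border rank of a tensor. -/
noncomputable def borderRank {ιa ιb ιc : Type*} (T : ιa → ιb → ιc → ℂ) : ℕ :=
  sInf {r | borderRankLE r T}

/-- The matrix multiplication tensor `M_⟨n⟩ = ∑_{i,j,k} x^i_j ⊗ y^j_k ⊗ z^k_i`, where
`A = U* ⊗ V`, `B = V* ⊗ W`, `C = W* ⊗ U` all have matrix-unit bases indexed by `Fin n × Fin n`. -/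
def matMulTensor (n : ℕ) : (Fin n × Fin n) → (Fin n × Fin n) → (Fin n × Fin n) → ℂ :=
  fun a b c => if a.2 = b.1 ∧ b.2 = c.1 ∧ c.2 = a.1 then 1 else 0

/-- The reduced matrix multiplication tensor
`M_⟨n⟩^red = M_⟨n⟩ − ∑_j x^1_n ⊗ y^n_j ⊗ z^j_1` (indices written 0-based). -/
def matMulRed (n : ℕ) (hn : 0 < n) :
    (Fin n × Fin n) → (Fin n × Fin n) → (Fin n × Fin n) → ℂ :=
  fun a b c =>
    matMulTensor n a b c -
      if a = (⟨0, hn⟩, ⟨n - 1, Nat.sub_lt hn Nat.one_pos⟩) ∧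
          b.1 = ⟨n - 1, Nat.sub_lt hn Nat.one_pos⟩ ∧ b.2 = c.1 ∧ c.2 = ⟨0, hn⟩
      then 1 else 0

open Topology Filter

theorem isClosed_setOf_rank_le {m n : Type*} [Fintype m] [Fintype n] (k : ℕ) :
    IsClosed {A : Matrix m n ℂ | A.rank ≤ k} := by
  classical
  let Φ : Matrix m n ℂ →ₗ[ℂ] ((n → ℂ) →L[ℂ] (m → ℂ)) :=
    (LinearMap.toContinuousLinearMap.toLinearMap) ∘ₗ (Matrix.toLin' (R := ℂ)).toLinearMap
  have hΦ : Continuous Φ := LinearMap.continuous_of_finiteDimensional Φ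
  have h := (isOpen_setOfPred_nat_le_rank (𝕜 := ℂ) (E := n → ℂ) (F := m → ℂ) (k + 1)).preimage hΦ
  have h' := h.isClosed_compl
  convert h' using 1
  ext A
  have : A.rank = Module.finrank ℂ (LinearMap.range (Matrix.toLin' A)) := rfl
  simp only [Set.mem_compl_iff, Set.mem_preimage, Set.mem_ofPred_eq, this, not_le, LinearMap.rank]
  rw [← Nat.lt_succ_iff, ← Module.finrank_eq_rank]
  simp only [Nat.cast_lt]
  rfl

theorem isClosed_exists_mem_of_isCompact {X Y : Type*} [TopologicalSpace X] [TopologicalSpace Y]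
    {K : Set Y} (hK : IsCompact K) {F : Set (X × Y)} (hF : IsClosed F) :
    IsClosed {x | ∃ y ∈ K, (x, y) ∈ F} := by
  have : CompactSpace K := isCompact_iff_compactSpace.mp hK
  have h := (isClosedMap_fst_of_compactSpace (X := X) (Y := K)) _
    (hF.preimage (continuous_fst.prodMk (continuous_subtype_val.comp continuous_snd)))
  convert h using 1
  ext x
  simp

section Tensors

variable {ιa ιb ιc : Type*}

theorem tensorRankLE.succ {r : ℕ} {T : ιa → ιb → ιc → ℂ} (h : tensorRankLE r T) :
    tensorRankLE (r + 1) T := by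
  obtain ⟨u, v, w, h⟩ := h
  refine ⟨Fin.cons 0 u, Fin.cons 0 v, Fin.cons 0 w, fun i j k => ?_⟩
  simp [Fin.sum_univ_succ, h]

theorem borderRankLE.mono {r s : ℕ} (hrs : r ≤ s) {T : ιa → ιb → ιc → ℂ}
    (h : borderRankLE r T) : borderRankLE s T := by
  induction hrs with
  | refl => exact h
  | step _ ih => exact closure_mono (fun _ hS => tensorRankLE.succ hS) ih

/-- Eliminating one rank-one summand by substituting along its `A`-factor. -/
theorem tensorRankLE.exists_substitution [Fintype ιa] [Nonempty ιa] {r : ℕ}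
    {T : ιa → ιb → ιc → ℂ} (h : tensorRankLE (r + 1) T) :
    ∃ a₀, ∃ u : ιa → ℂ, ‖u‖ ≤ 1 ∧ u a₀ = 1 ∧
      tensorRankLE r fun a b c => T a b c - u a * T a₀ b c := by
  classical
  obtain ⟨u, v, w, h⟩ := h
  obtain ⟨a₀, -, ha₀⟩ := Finset.exists_max_image Finset.univ (fun a => ‖u 0 a‖)
    Finset.univ_nonempty
  by_cases h0 : u 0 a₀ = 0
  · have hu : u 0 = 0 := by
      ext a
      have := ha₀ a (Finset.mem_univ a)
      simpa [h0] using this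
    refine ⟨a₀, Pi.single a₀ 1, ?_, by simp, fun l a => u l.succ a -
      (Pi.single a₀ 1 : ιa → ℂ) a * u l.succ a₀, fun l => v l.succ, fun l => w l.succ, ?_⟩
    · rw [pi_norm_le_iff_of_nonneg zero_le_one]
      intro a
      rw [Pi.single_apply]
      split_ifs <;> simp
    · intro a b c
      beta_reduce
      rw [h, h, Fin.sum_univ_succ, Fin.sum_univ_succ]
      simp only [hu, Pi.zero_apply, zero_mul, zero_add, Finset.mul_sum, ← Finset.sum_sub_distrib]
      exact Finset.sum_congr rfl fun l _ => by ring
  · refine ⟨a₀, fun a => u 0 a / u 0 a₀, ?_, by simp [h0], fun l a => u l.succ a -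
      u 0 a / u 0 a₀ * u l.succ a₀, fun l => v l.succ, fun l => w l.succ, ?_⟩
    · rw [pi_norm_le_iff_of_nonneg zero_le_one]
      intro a
      rw [norm_div]
      exact div_le_one_of_le₀ (ha₀ a (Finset.mem_univ a)) (norm_nonneg _)
    · intro a b c
      beta_reduce
      rw [h, h, Fin.sum_univ_succ, Fin.sum_univ_succ, mul_add, Finset.mul_sum,
        add_sub_add_comm, ← Finset.sum_sub_distrib]
      have : u 0 a * v 0 b * w 0 c - u 0 a / u 0 a₀ * (u 0 a₀ * v 0 b * w 0 c) = 0 := by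
        field_simp; ring
      rw [this, zero_add]
      exact Finset.sum_congr rfl fun l _ => by ring

/-- The border rank version of the substitution method. -/
theorem borderRankLE.exists_substitution [Fintype ιa] [Nonempty ιa] {r : ℕ}
    {T : ιa → ιb → ιc → ℂ} (h : borderRankLE (r + 1) T) :
    ∃ a₀, ∃ u : ιa → ℂ, u a₀ = 1 ∧ borderRankLE r fun a b c => T a b c - u a * T a₀ b c := by
  let K (a₀ : ιa) : Set (ιa → ℂ) := Metric.closedBall 0 1 ∩ {u | u a₀ = 1}
  let F (a₀ : ιa) : Set ((ιa → ιb → ιc → ℂ) × (ιa → ℂ)) :=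
    {x | (fun a b c => x.1 a b c - x.2 a * x.1 a₀ b c) ∈
      closure {S : ιa → ιb → ιc → ℂ | tensorRankLE r S}}
  have hK (a₀ : ιa) : IsCompact (K a₀) :=
    (isCompact_closedBall _ _).inter_right
      (isClosed_eq (continuous_apply a₀) continuous_const)
  have hF (a₀ : ιa) : IsClosed (F a₀) := by
    refine isClosed_closure.preimage ?_
    fun_prop
  have hC : IsClosed (⋃ a₀, {x | ∃ y ∈ K a₀, (x, y) ∈ F a₀}) :=
    isClosed_iUnion_of_finite fun a₀ => isClosed_exists_mem_of_isCompact (hK a₀) (hF a₀)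
  have hsub : {S : ιa → ιb → ιc → ℂ | tensorRankLE (r + 1) S} ⊆
      ⋃ a₀, {x | ∃ y ∈ K a₀, (x, y) ∈ F a₀} := by
    intro S hS
    obtain ⟨a₀, u, hu, hu1, hr⟩ := tensorRankLE.exists_substitution hS
    exact Set.mem_iUnion.mpr ⟨a₀, u, ⟨by simpa using hu, hu1⟩, subset_closure hr⟩
  obtain ⟨a₀, u, hu, hr⟩ := Set.mem_iUnion.mp (closure_minimal hsub hC h)
  exact ⟨a₀, u, hu.2, hr⟩

theorem borderRankLE.scale {r : ℕ} {T : ιa → ιb → ιc → ℂ} (h : borderRankLE r T)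
    (x : ιa → ℂ) (y : ιb → ℂ) (z : ιc → ℂ) :
    borderRankLE r fun a b c => x a * y b * z c * T a b c := by
  refine map_mem_closure (f := fun (S : ιa → ιb → ιc → ℂ) a b c => x a * y b * z c * S a b c)
    (by fun_prop) h ?_
  rintro S ⟨u, v, w, hS⟩
  refine ⟨fun l a => x a * u l a, fun l b => y b * v l b, fun l c => z c * w l c, ?_⟩
  intro a b c
  simp only [hS, Finset.mul_sum]
  exact Finset.sum_congr rfl fun l _ => by ring

end Tensors

/-- A torus degeneration turns the slice removed by substitution into a coordinate slice. -/
theorem borderRankLE_matMulTensor_erase_slice {n r : ℕ} (hn : 0 < n)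
    (h : borderRankLE (r + 1) (matMulTensor n)) :
    ∃ a₀, borderRankLE r fun a b c => if a = a₀ then 0 else matMulTensor n a b c := by
  have : Nonempty (Fin n) := ⟨⟨0, hn⟩⟩
  obtain ⟨a₀, u, hu, h⟩ := h.exists_substitution
  refine ⟨a₀, ?_⟩
  let χ (s : ℂ) (i i₀ : Fin n) : ℂ := if i = i₀ then 1 else s
  let G (s : ℂ) : (Fin n × Fin n) → (Fin n × Fin n) → (Fin n × Fin n) → ℂ := fun a b c =>
    matMulTensor n a b c - χ s a.1 a₀.1 * χ s a.2 a₀.2 * u a * matMulTensor n a₀ b c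
  have hG (s : ℂ) (hs : s ≠ 0) : borderRankLE r (G s) := by
    have hχ (i i₀) : χ s i i₀ ≠ 0 := by
      simp only [χ]; split_ifs <;> simp [hs]
    have := h.scale (fun a => χ s a.1 a₀.1 * χ s a.2 a₀.2) (fun b => (χ s b.1 a₀.2)⁻¹)
      (fun c => (χ s c.2 a₀.1)⁻¹)
    convert this using 1
    ext a b c
    simp only [G, matMulTensor]
    rw [mul_sub]
    congr 1
    · split_ifs with hc
      · rw [← hc.1, hc.2.2]
        have h1 := hχ a.1 a₀.1
        have h2 := hχ a.2 a₀.2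
        field_simp
      · simp
    · split_ifs with hc
      · rw [← hc.1, hc.2.2]
        simp [χ]
      · simp
  have hcont : Continuous G := by
    have (i i₀ : Fin n) : Continuous fun s => χ s i i₀ := by
      simp only [χ]; split_ifs <;> fun_prop
    fun_prop
  have hmem : Set.MapsTo G {s : ℂ | s ≠ 0} (closure {S | tensorRankLE r S}) := fun s hs => hG s hs
  have h0 : (0 : ℂ) ∈ closure {s : ℂ | s ≠ 0} := (dense_compl_singleton (0 : ℂ)) 0
  have := map_mem_closure hcont h0 hmem
  rw [closure_closure] at this
  suffices hG0 : (fun a b c => if a = a₀ then 0 else matMulTensor n a b c) = G 0 by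
    rw [hG0]; exact this
  ext a b c
  simp only [G, χ]
  by_cases ha : a = a₀
  · subst ha
    simp [hu]
  · rw [if_neg ha]
    have : ¬ (a.1 = a₀.1 ∧ a.2 = a₀.2) := fun h => ha (Prod.ext h.1 h.2)
    by_cases h1 : a.1 = a₀.1
    · have h2 : ¬ a.2 = a₀.2 := fun h2 => this ⟨h1, h2⟩
      simp [h2]
    · simp [h1]

section Combinatorics

/-- There is no infinite process in which a finite set of occupied positions evolves together with
a bounded vacant pointer such that the pointer's position gets filled at every step and only
positions strictly below one of the two consecutive pointers get vacated. -/
theorem not_bounded_pointer_process (B : ℕ) : ∀ (S : ℕ → Finset ℕ) (p : ℕ → ℕ),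
    (∀ k, p k ∉ S k) → (∀ k, p k ∈ S (k + 1)) →
    (∀ k x, x ∈ S k → x ∉ S (k + 1) → x < p k ∨ x < p (k + 1)) → ¬ ∀ k, p k < B := by
  induction B with
  | zero => exact fun S p _ _ _ h => absurd (h 0) (Nat.not_lt_zero _)
  | succ B ih =>
    intro S p hp hfill hvac hB
    by_cases hN : ∃ N, ∀ k, N ≤ k → p k < B
    · obtain ⟨N, hN⟩ := hN
      refine ih (fun k => S (k + N)) (fun k => p (k + N)) (fun k => hp _) (fun k => ?_)
        (fun k x hx hx' => ?_) (fun k => hN _ (Nat.le_add_left _ _))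
      · rw [add_right_comm]; exact hfill _
      · rw [add_right_comm] at hx' ⊢
        exact hvac _ x hx hx'
    · push Not at hN
      obtain ⟨k, -, hk⟩ := hN 0
      have hkB : p k = B := by have := hB k; omega
      have hstay (d : ℕ) : B ∈ S (k + 1 + d) := by
        induction d with
        | zero => simpa [hkB] using hfill k
        | succ d ihd =>
          by_contra hcon
          have h1 := hB (k + 1 + d)
          have h2 := hB (k + 1 + d + 1)
          rcases hvac _ B ihd hcon with h | h <;> omega
      obtain ⟨l, hl, hlB⟩ := hN (k + 1)
      obtain ⟨d, rfl⟩ := Nat.exists_eq_add_of_le hl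
      have := hB (k + 1 + d)
      have hpB : p (k + 1 + d) = B := by omega
      exact hp (k + 1 + d) (hpB ▸ hstay d)

theorem count_notMem_add_card_filter_lt (S : Finset ℕ) (x : ℕ) :
    Nat.count (fun m => m ∉ S) x + (S.filter (· < x)).card = x := by
  have h : S.filter (· < x) = (Finset.range x).filter (· ∈ S) := by
    ext a; simp [and_comm]
  rw [Nat.count_eq_card_filter_range, h, add_comm, Finset.card_filter_add_card_filter_not,
    Finset.card_range]

theorem infinite_setOf_notMem (S : Finset ℕ) : (Set.ofPred fun m => m ∉ S).Infinite :=
  S.finite_toSet.infinite_compl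

/-- The sign of the insertion of `m` into the ordered wedge product indexed by `S`. -/
noncomputable def wedgeSign (S : Finset ℕ) (m : ℕ) : ℂ := (-1) ^ (S.filter (· < m)).card

theorem wedgeSign_ne_zero (S : Finset ℕ) (m : ℕ) : wedgeSign S m ≠ 0 :=
  pow_ne_zero _ (by norm_num)

variable {n : ℕ} {y : Finset ℕ → ℕ → ℂ}

theorem exists_successor_of_hankel_kernel
    (hy : y (Finset.Ico n (2 * n - 1)) (n - 1) = 0)
    (heq : ∀ T ∈ Finset.powersetCard n (Finset.range (2 * n - 1)), ∀ i < n,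
      ∑ j ∈ Finset.range n, (if i + j ∈ T ∧ ¬ (i = 0 ∧ j = n - 1) then
        wedgeSign (T.erase (i + j)) (i + j) * y (T.erase (i + j)) j else 0) = 0)
    {S : Finset ℕ} (hS : S ∈ Finset.powersetCard (n - 1) (Finset.range (2 * n - 1)))
    {j : ℕ} (hj : j < n) (hne : y S j ≠ 0) :
    ∃ S' ∈ Finset.powersetCard (n - 1) (Finset.range (2 * n - 1)), ∃ j' < n, y S' j' ≠ 0 ∧
      Nat.nth (· ∉ S) j ∈ S' ∧
      ∀ x ∈ S, x ∉ S' → x < Nat.nth (· ∉ S) j ∨ x < Nat.nth (· ∉ S') j' := by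
  obtain ⟨hSsub, hScard⟩ := Finset.mem_powersetCard.mp hS
  set m := Nat.nth (· ∉ S) j with hm
  have hmS : m ∉ S := Nat.nth_mem_of_infinite (infinite_setOf_notMem S) j
  have hcount : Nat.count (fun a => a ∉ S) m = j :=
    Nat.count_nth_of_infinite (infinite_setOf_notMem S) j
  have hadd := count_notMem_add_card_filter_lt S m
  set i := (S.filter (· < m)).card with hi
  have hile : i ≤ n - 1 := hScard ▸ Finset.card_filter_le _ _
  have him : i + j = m := by omega
  have hTcard : (insert m S).card = n := by rw [Finset.card_insert_of_notMem hmS]; omega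
  have hTsub : insert m S ⊆ Finset.range (2 * n - 1) :=
    Finset.insert_subset (Finset.mem_range.mpr (by omega)) hSsub
  have hspecial : ¬ (i = 0 ∧ j = n - 1) := by
    rintro ⟨hi0, hjn⟩
    refine hne ?_
    have hSI : S = Finset.Ico n (2 * n - 1) := by
      refine Finset.eq_of_subset_of_card_le (fun s hs => ?_) (by simp; omega)
      have h1 := Finset.mem_range.mp (hSsub hs)
      have h2 : ¬ s < m := fun h => by
        have : s ∈ S.filter (· < m) := Finset.mem_filter.mpr ⟨hs, h⟩
        rw [Finset.card_eq_zero.mp (hi.symm.trans hi0)] at this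
        exact absurd this (Finset.notMem_empty s)
      have h3 : s ≠ m := fun h => hmS (h ▸ hs)
      exact Finset.mem_Ico.mpr ⟨by omega, h1⟩
    rw [hSI, hjn, hy]
  have hsum := heq _ (Finset.mem_powersetCard.mpr ⟨hTsub, hTcard⟩) i (by omega)
  obtain ⟨j', hj', hjj, hterm⟩ : ∃ j' ∈ Finset.range n, j' ≠ j ∧
      (if i + j' ∈ insert m S ∧ ¬ (i = 0 ∧ j' = n - 1) then
        wedgeSign ((insert m S).erase (i + j')) (i + j') *
          y ((insert m S).erase (i + j')) j' else 0) ≠ 0 := by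
    by_contra hcon
    rw [Finset.sum_eq_single_of_mem j (Finset.mem_range.mpr hj)
      (fun b hb hbj => by_contra fun h => hcon ⟨b, hb, hbj, h⟩), him,
      if_pos ⟨Finset.mem_insert_self _ _, hspecial⟩, Finset.erase_insert hmS] at hsum
    exact mul_ne_zero (wedgeSign_ne_zero _ _) hne hsum
  rw [Finset.mem_range] at hj'
  rw [ite_ne_right_iff] at hterm
  obtain ⟨⟨hm'T, -⟩, hterm⟩ := hterm
  set m' := i + j' with hm'
  have hmm : m' ≠ m := by omega
  have hm'S : m' ∈ S := (Finset.mem_insert.mp hm'T).resolve_left hmm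
  set S' := (insert m S).erase m' with hS'
  refine ⟨S', Finset.mem_powersetCard.mpr ⟨(Finset.erase_subset _ _).trans hTsub, ?_⟩, j', hj',
    right_ne_zero_of_mul hterm, Finset.mem_erase.mpr ⟨hmm.symm, Finset.mem_insert_self _ _⟩, ?_⟩
  · rw [Finset.card_erase_of_mem hm'T, hTcard]
  · intro x hxS hxS'
    have hx : x = m' := by
      by_contra hx
      exact hxS' (Finset.mem_erase.mpr ⟨hx, Finset.mem_insert_of_mem hxS⟩)
    subst hx
    rcases lt_or_gt_of_ne hmm with hlt | hgt
    · exact Or.inl hlt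
    · right
      have hcount' := Nat.count_nth_of_infinite (infinite_setOf_notMem S') j'
      have hadd' := count_notMem_add_card_filter_lt S' m'
      have hcard : i + 1 ≤ (S'.filter (· < m')).card := by
        have hnot : m ∉ S.filter (· < m) := by simp
        rw [hi, ← Finset.card_insert_of_notMem hnot]
        refine Finset.card_le_card fun a ha => ?_
        rcases Finset.mem_insert.mp ha with rfl | ha
        · exact Finset.mem_filter.mpr
            ⟨Finset.mem_erase.mpr ⟨hmm.symm, Finset.mem_insert_self _ _⟩, hgt⟩
        · obtain ⟨ha1, ha2⟩ := Finset.mem_filter.mp ha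
          exact Finset.mem_filter.mpr
            ⟨Finset.mem_erase.mpr ⟨by omega, Finset.mem_insert_of_mem ha1⟩, by omega⟩
      by_contra! hle
      have := Nat.count_monotone (fun a => a ∉ S') hle
      omega

/-- The Koszul flattening of the Hankel matrix with a corner of its antidiagonal removed has
kernel determined by a single coordinate. -/
theorem hankel_kernel_eq_zero
    (hy : y (Finset.Ico n (2 * n - 1)) (n - 1) = 0)
    (heq : ∀ T ∈ Finset.powersetCard n (Finset.range (2 * n - 1)), ∀ i < n,
      ∑ j ∈ Finset.range n, (if i + j ∈ T ∧ ¬ (i = 0 ∧ j = n - 1) then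
        wedgeSign (T.erase (i + j)) (i + j) * y (T.erase (i + j)) j else 0) = 0)
    {S : Finset ℕ} (hS : S ∈ Finset.powersetCard (n - 1) (Finset.range (2 * n - 1)))
    {j : ℕ} (hj : j < n) : y S j = 0 := by
  by_contra hne
  let Z := {s : Finset ℕ × ℕ // s.1 ∈ Finset.powersetCard (n - 1) (Finset.range (2 * n - 1)) ∧
    s.2 < n ∧ y s.1 s.2 ≠ 0}
  have hstep (z : Z) : ∃ z' : Z, Nat.nth (· ∉ z.1.1) z.1.2 ∈ z'.1.1 ∧
      ∀ x ∈ z.1.1, x ∉ z'.1.1 →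
        x < Nat.nth (· ∉ z.1.1) z.1.2 ∨ x < Nat.nth (· ∉ z'.1.1) z'.1.2 := by
    obtain ⟨S', hS', j', hj', hne', h⟩ :=
      exists_successor_of_hankel_kernel hy heq z.2.1 z.2.2.1 z.2.2.2
    exact ⟨⟨(S', j'), hS', hj', hne'⟩, h⟩
  choose g hg using hstep
  let f (k : ℕ) : Z := g^[k] ⟨(S, j), hS, hj, hne⟩
  have hf (k : ℕ) : f (k + 1) = g (f k) := Function.iterate_succ_apply' _ _ _
  refine not_bounded_pointer_process (2 * n) (fun k => (f k).1.1)
    (fun k => Nat.nth (· ∉ (f k).1.1) (f k).1.2)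
    (fun k => Nat.nth_mem_of_infinite (infinite_setOf_notMem _) _) (fun k => ?_)
    (fun k => ?_) (fun k => ?_)
  · rw [hf]; exact (hg (f k)).1
  · rw [hf]; exact (hg (f k)).2
  · have h1 := count_notMem_add_card_filter_lt (f k).1.1 (Nat.nth (· ∉ (f k).1.1) (f k).1.2)
    rw [Nat.count_nth_of_infinite (infinite_setOf_notMem _)] at h1
    have h2 := Finset.card_filter_le (f k).1.1 (· < Nat.nth (· ∉ (f k).1.1) (f k).1.2)
    have h3 := (Finset.mem_powersetCard.mp (f k).2.1).2
    have h4 := (f k).2.2.1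
    omega

end Combinatorics

section Koszul

theorem Matrix.rank_add_le_rank_add_rank {m n K : Type*} [Fintype m] [Fintype n] [Field K]
    (A B : Matrix m n K) : (A + B).rank ≤ A.rank + B.rank := by
  have h : LinearMap.range (A + B).mulVecLin ≤
      LinearMap.range A.mulVecLin ⊔ LinearMap.range B.mulVecLin := by
    rw [Matrix.mulVecLin_add]
    rintro _ ⟨x, rfl⟩
    exact Submodule.add_mem_sup ⟨x, rfl⟩ ⟨x, rfl⟩
  exact (Submodule.finrank_mono h).trans (Submodule.finrank_add_le_finrank_add_finrank _ _)

theorem Matrix.rank_sum_le_card_mul {ι m n K : Type*} [Fintype m] [Fintype n] [Field K]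
    (s : Finset ι) (A : ι → Matrix m n K) {k : ℕ} (h : ∀ i ∈ s, (A i).rank ≤ k) :
    (∑ i ∈ s, A i).rank ≤ s.card * k := by
  classical
  induction s using Finset.induction_on with
  | empty => simp
  | insert i s hi ih =>
    rw [Finset.sum_insert hi, Finset.card_insert_of_notMem hi, add_mul, one_mul]
    have h1 := Matrix.rank_add_le_rank_add_rank (A i) (∑ j ∈ s, A j)
    have h2 := ih fun j hj => h j (Finset.mem_insert_of_mem hj)
    have h3 := h i (Finset.mem_insert_self _ _)
    linarith

/-- The matrix coefficient at `S`, `T` of the wedge product with the vector `y`. -/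
noncomputable def wedgeEntry (y : ℕ → ℂ) (S T : Finset ℕ) : ℂ :=
  ∑ m ∈ T, if T.erase m = S then wedgeSign S m * y m else 0

theorem wedgeEntry_sum_mul {ι : Type*} (s : Finset ι) (u : ι → ℂ) (f : ι → ℕ → ℂ)
    (S T : Finset ℕ) :
    wedgeEntry (fun m => ∑ a ∈ s, u a * f a m) S T = ∑ a ∈ s, u a * wedgeEntry (f a) S T := by
  simp only [wedgeEntry, Finset.mul_sum]
  rw [Finset.sum_comm]
  refine Finset.sum_congr rfl fun m _ => ?_
  split_ifs
  · exact Finset.sum_congr rfl fun a _ => by ring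
  · simp

theorem wedgeEntry_single (m : ℕ) (S T : Finset ℕ) :
    wedgeEntry (Pi.single m 1) S T = if m ∈ T ∧ T.erase m = S then wedgeSign S m else 0 := by
  rw [wedgeEntry, ite_and]
  by_cases hm : m ∈ T
  · rw [Finset.sum_eq_single_of_mem m hm, if_pos hm]
    · simp
    · intro b _ hb
      simp [Pi.single_eq_of_ne hb]
  · rw [if_neg hm]
    refine Finset.sum_eq_zero fun b hb => ?_
    have : b ≠ m := fun h => hm (h ▸ hb)
    simp [Pi.single_eq_of_ne this]

theorem wedgeSign_insert {S : Finset ℕ} {a b : ℕ} (ha : a ∉ S) :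
    wedgeSign (insert a S) b = (if a < b then -1 else 1) * wedgeSign S b := by
  rw [wedgeSign, wedgeSign, Finset.filter_insert]
  split_ifs with h
  · rw [Finset.card_insert_of_notMem (by simp [ha]), pow_succ]; ring
  · rw [one_mul]

/-- The wedge product with `y` squares to zero. -/
theorem sum_wedgeSign_mul_wedgeEntry (y : ℕ → ℂ) (R T : Finset ℕ) {N : ℕ}
    (hT : T ⊆ Finset.range N) :
    ∑ m ∈ Finset.range N \ R, wedgeSign R m * y m * wedgeEntry y (insert m R) T = 0 := by
  have h1 : ∑ m ∈ Finset.range N \ R, wedgeSign R m * y m * wedgeEntry y (insert m R) T =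
      ∑ x ∈ (Finset.range N \ R) ×ˢ T, if T.erase x.2 = insert x.1 R then
        wedgeSign R x.1 * y x.1 * (wedgeSign (insert x.1 R) x.2 * y x.2) else 0 := by
    rw [Finset.sum_product]
    simp only [wedgeEntry, Finset.mul_sum, mul_ite, mul_zero]
  rw [h1, ← Finset.sum_filter]
  have hmem (x : ℕ × ℕ) (hx : x ∈ ((Finset.range N \ R) ×ˢ T).filter
      fun x => T.erase x.2 = insert x.1 R) : x.1 ∉ R ∧ x.2 ∉ R ∧ x.1 ≠ x.2 ∧ x.1 ∈ T ∧ x.2 ∈ T ∧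
        T = insert x.2 (insert x.1 R) := by
    simp only [Finset.mem_filter, Finset.mem_product, Finset.mem_sdiff] at hx
    obtain ⟨⟨⟨-, h1⟩, h2⟩, h3⟩ := hx
    have h4 : x.2 ∉ insert x.1 R := h3 ▸ Finset.notMem_erase _ _
    have h5 : T = insert x.2 (insert x.1 R) := by rw [← h3, Finset.insert_erase h2]
    rw [Finset.mem_insert, not_or] at h4
    exact ⟨h1, h4.2, fun h => h4.1 h.symm, h5 ▸ by simp, h2, h5⟩
  refine Finset.sum_involution (fun x _ => x.swap) (fun x hx => ?_) (fun x hx _ h => ?_)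
    (fun x hx => ?_) (fun x _ => Prod.swap_swap x)
  · obtain ⟨h1, h2, h3, -⟩ := hmem x hx
    simp only [Prod.fst_swap, Prod.snd_swap]
    rw [wedgeSign_insert h1, wedgeSign_insert h2]
    rcases lt_or_gt_of_ne h3 with h | h
    · rw [if_pos h, if_neg h.not_gt]; ring
    · rw [if_pos h, if_neg h.not_gt]; ring
  · exact (hmem x hx).2.2.1 (congrArg Prod.snd h)
  · obtain ⟨h1, h2, h3, h4, h5, h6⟩ := hmem x hx
    simp only [Finset.mem_filter, Finset.mem_product, Finset.mem_sdiff, Prod.fst_swap,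
      Prod.snd_swap]
    refine ⟨⟨⟨hT h5, h2⟩, h4⟩, ?_⟩
    have h7 : x.1 ∉ insert x.2 R := by
      rw [Finset.mem_insert, not_or]; exact ⟨h3, h1⟩
    rw [h6, Finset.insert_comm, Finset.erase_insert h7]

/-- The matrix of the wedge product with `y` from degree `k` to degree `k + 1` in an
`N`-dimensional space. -/
noncomputable def wedgeMatrix (N k : ℕ) (y : ℕ → ℂ) :
    Matrix (Finset.powersetCard k (Finset.range N)) (Finset.powersetCard (k + 1) (Finset.range N))
      ℂ :=
  Matrix.of fun S T => wedgeEntry y S T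

theorem rank_wedgeMatrix_le (N k : ℕ) (y : ℕ → ℂ) :
    (wedgeMatrix N k y).rank ≤ (N - 1).choose k := by
  by_cases hy : ∃ m₀ < N, y m₀ ≠ 0
  swap
  · push Not at hy
    have : wedgeMatrix N k y = 0 := by
      ext S T
      refine Finset.sum_eq_zero fun m hm => ?_
      have := Finset.mem_range.mp ((Finset.mem_powersetCard.mp T.2).1 hm)
      simp [hy m this]
    simp [this]
  obtain ⟨m₀, hm₀, hym₀⟩ := hy
  let row (S : Finset ℕ) : Finset.powersetCard (k + 1) (Finset.range N) → ℂ :=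
    fun T => wedgeEntry y S T
  let P := Finset.powersetCard k ((Finset.range N).erase m₀)
  have hspan : Submodule.span ℂ (Set.range (wedgeMatrix N k y).row) ≤
      Submodule.span ℂ (Set.range fun S : P => row S) := by
    rw [Submodule.span_le]
    rintro _ ⟨⟨S, hS⟩, rfl⟩
    obtain ⟨hSsub, hScard⟩ := Finset.mem_powersetCard.mp hS
    change row S ∈ Submodule.span ℂ (Set.range fun S : P => row S)
    by_cases hm₀S : m₀ ∈ S
    swap
    · refine Submodule.subset_span ⟨⟨S, Finset.mem_powersetCard.mpr ⟨?_, hScard⟩⟩, rfl⟩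
      exact Finset.subset_erase.mpr ⟨hSsub, hm₀S⟩
    set R := S.erase m₀ with hR
    have hRS : insert m₀ R = S := Finset.insert_erase hm₀S
    have hrel : ∑ m ∈ Finset.range N \ R, (wedgeSign R m * y m) • row (insert m R) = 0 := by
      ext T
      rw [Finset.sum_apply]
      exact sum_wedgeSign_mul_wedgeEntry y R T (Finset.mem_powersetCard.mp T.2).1
    have hmem : m₀ ∈ Finset.range N \ R := by simp [hR, hm₀]
    rw [← Finset.add_sum_erase _ _ hmem, hRS] at hrel
    have hc : wedgeSign R m₀ * y m₀ ≠ 0 := mul_ne_zero (wedgeSign_ne_zero _ _) hym₀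
    rw [← Submodule.smul_mem_iff _ hc, eq_neg_of_add_eq_zero_left hrel]
    refine Submodule.neg_mem _ (Submodule.sum_mem _ fun m hm => Submodule.smul_mem _ _ ?_)
    simp only [Finset.mem_erase, Finset.mem_sdiff, Finset.mem_range] at hm
    refine Submodule.subset_span ⟨⟨insert m R, Finset.mem_powersetCard.mpr ⟨?_, ?_⟩⟩, rfl⟩
    · refine Finset.subset_erase.mpr ⟨Finset.insert_subset (Finset.mem_range.mpr hm.2.1)
        ((Finset.erase_subset _ _).trans hSsub), ?_⟩
      simp [hR, hm.1.symm]
    · rw [Finset.card_insert_of_notMem hm.2.2, hR, Finset.card_erase_add_one hm₀S, hScard]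
  rw [Matrix.rank_eq_finrank_span_row]
  refine (Submodule.finrank_mono hspan).trans ((finrank_range_le_card _).trans ?_)
  rw [Fintype.card_coe, Finset.card_powersetCard, Finset.card_erase_of_mem (by simpa using hm₀),
    Finset.card_range]

variable {ιa ιb ιc : Type*} [Fintype ιa]

/-- The Koszul flattening of `T` after restricting its first factor along `π`. -/
noncomputable def koszulFlattening (N k : ℕ) (π : ιa → ℕ → ℂ) (T : ιa → ιb → ιc → ℂ) :
    Matrix (Finset.powersetCard k (Finset.range N) × ιb)
      (Finset.powersetCard (k + 1) (Finset.range N) × ιc) ℂ :=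
  Matrix.of fun x z => ∑ a, T a x.2 z.2 * wedgeEntry (π a) x.1 z.1

variable [Fintype ιb] [Fintype ιc]

theorem rank_koszulFlattening_le_of_tensorRankLE (N k : ℕ) (π : ιa → ℕ → ℂ) {r : ℕ}
    {T : ιa → ιb → ιc → ℂ} (h : tensorRankLE r T) :
    (koszulFlattening N k π T).rank ≤ r * (N - 1).choose k := by
  classical
  obtain ⟨u, v, w, h⟩ := h
  let E (l : Fin r) := wedgeMatrix N k fun m => ∑ a, u l a * π a m
  let X (l : Fin r) : Matrix (Finset.powersetCard k (Finset.range N) × ιb)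
      (Finset.powersetCard k (Finset.range N)) ℂ :=
    Matrix.of fun x S => if S = x.1 then v l x.2 else 0
  let Y (l : Fin r) : Matrix (Finset.powersetCard (k + 1) (Finset.range N))
      (Finset.powersetCard (k + 1) (Finset.range N) × ιc) ℂ :=
    Matrix.of fun S z => if S = z.1 then w l z.2 else 0
  have hsum : koszulFlattening N k π T = ∑ l, X l * E l * Y l := by
    ext x z
    have (l : Fin r) : (X l * E l * Y l) x z = v l x.2 * E l x.1 z.1 * w l z.2 := by
      simp [X, Y, Matrix.mul_apply]
    simp only [Matrix.sum_apply, this]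
    simp only [koszulFlattening, Matrix.of_apply, h, E, wedgeMatrix, wedgeEntry_sum_mul,
      Finset.sum_mul, Finset.mul_sum]
    rw [Finset.sum_comm]
    exact Finset.sum_congr rfl fun l _ => Finset.sum_congr rfl fun a _ => by ring
  rw [hsum]
  refine (Matrix.rank_sum_le_card_mul (k := (N - 1).choose k) _ _ fun l _ => ?_).trans_eq (by simp)
  exact ((Matrix.rank_mul_le_left _ _).trans (Matrix.rank_mul_le_right _ _)).trans
    (rank_wedgeMatrix_le N k _)

theorem rank_koszulFlattening_le_of_borderRankLE (N k : ℕ) (π : ιa → ℕ → ℂ) {r : ℕ}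
    {T : ιa → ιb → ιc → ℂ} (h : borderRankLE r T) :
    (koszulFlattening N k π T).rank ≤ r * (N - 1).choose k := by
  have hcont : Continuous fun S : ιa → ιb → ιc → ℂ => koszulFlattening N k π S := by
    refine continuous_matrix fun x z => ?_
    simp only [koszulFlattening, Matrix.of_apply]
    fun_prop
  exact closure_minimal (fun S hS => rank_koszulFlattening_le_of_tensorRankLE N k π hS)
    ((isClosed_setOf_rank_le _).preimage hcont) h

end Koszul

section LowerBound

open scoped Matrix

theorem Matrix.rank_add_finrank_ker_vecMulLinear {m n K : Type*} [Fintype m] [Fintype n]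
    [Field K] (A : Matrix m n K) :
    A.rank + Module.finrank K (LinearMap.ker A.vecMulLinear) = Fintype.card m := by
  classical
  rw [← Matrix.rank_transpose, Matrix.rank, ← Matrix.vecMulLinear_transpose,
    Matrix.transpose_transpose, LinearMap.finrank_range_add_finrank_ker,
    Module.finrank_fintype_fun_eq_card]

theorem Matrix.card_le_rank_add_card {m n ι K : Type*} [Fintype m] [Fintype n] [Fintype ι]
    [Field K] (A : Matrix m n K) (p : ι → m)
    (h : ∀ x : m → K, x ᵥ* A = 0 → (∀ i, x (p i) = 0) → x = 0) :
    Fintype.card m ≤ A.rank + Fintype.card ι := by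
  let f : LinearMap.ker A.vecMulLinear →ₗ[K] (ι → K) :=
    (LinearMap.funLeft K K p).comp (LinearMap.ker A.vecMulLinear).subtype
  have hf : Function.Injective f := by
    rw [← LinearMap.ker_eq_bot, LinearMap.ker_eq_bot']
    rintro ⟨x, hx⟩ hfx
    exact Subtype.ext (h x hx fun i => congrFun hfx i)
  have h1 := LinearMap.finrank_le_finrank_of_injective hf
  rw [Module.finrank_fintype_fun_eq_card] at h1
  have h2 := A.rank_add_finrank_ker_vecMulLinear
  omega

/-- The Koszul flattening bound for matrix multiplication, after substitution. -/
theorem mul_choose_le_of_borderRankLE_matMulTensor {m r : ℕ}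
    (h : borderRankLE (r + 1) (matMulTensor (m + 1))) :
    (m + 1) ^ 2 * (2 * m + 1).choose m ≤ r * (2 * m).choose m + (m + 1) := by
  obtain ⟨a₀, h⟩ := borderRankLE_matMulTensor_erase_slice m.succ_pos h
  let σ : Equiv.Perm (Fin (m + 1)) := Equiv.swap a₀.1 0
  let τ : Equiv.Perm (Fin (m + 1)) := Equiv.swap a₀.2 (Fin.last m)
  have hσ : σ a₀.1 = 0 := Equiv.swap_apply_left _ _
  have hτ : τ a₀.2 = Fin.last m := Equiv.swap_apply_left _ _
  let π (a : Fin (m + 1) × Fin (m + 1)) : ℕ → ℂ := Pi.single ((σ a.1 : ℕ) + τ a.2) 1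
  have hle := rank_koszulFlattening_le_of_borderRankLE (2 * m + 1) m π h
  have hS₀ : Finset.Ico (m + 1) (2 * m + 1) ∈
      Finset.powersetCard m (Finset.range (2 * m + 1)) := by
    rw [Finset.mem_powersetCard, Nat.card_Ico, Finset.range_eq_Ico]
    exact ⟨Finset.Ico_subset_Ico_left (Nat.zero_le _), by omega⟩
  have hcard := Matrix.card_le_rank_add_card (ι := Fin (m + 1))
    (p := fun k => ((⟨_, hS₀⟩, (τ.symm (Fin.last m), k)) :
      Finset.powersetCard m (Finset.range (2 * m + 1)) × (Fin (m + 1) × Fin (m + 1))))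
    (A := koszulFlattening (2 * m + 1) m π
      fun a b c => if a = a₀ then 0 else matMulTensor (m + 1) a b c) ?_
  · simp only [Fintype.card_prod, Fintype.card_coe, Finset.card_powersetCard, Finset.card_range,
      Fintype.card_fin] at hcard
    have : 2 * m + 1 - 1 = 2 * m := by omega
    rw [this] at hle
    nlinarith
  intro x hx hx₀
  ext ⟨⟨S, hS⟩, j, k⟩
  let y (S : Finset ℕ) (t : ℕ) : ℂ :=
    if hS : S ∈ Finset.powersetCard m (Finset.range (2 * m + 1)) then
      if ht : t < m + 1 then x (⟨S, hS⟩, (τ.symm ⟨t, ht⟩, k)) else 0 else 0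
  have hy := hankel_kernel_eq_zero (n := m + 1) (y := y) ?_ ?_ (S := S) (j := τ j) hS (τ j).2
  · simp only [y, dif_pos hS, dif_pos (τ j).2, Fin.eta, Equiv.symm_apply_apply] at hy
    exact hy
  · have := hx₀ k
    change y (Finset.Ico (m + 1) (2 * m + 1)) m = 0
    simp only [y, dif_pos hS₀, dif_pos (Nat.lt_succ_self m)]
    exact this
  intro T hT i hi
  have hxT := congrFun hx (⟨T, hT⟩, (k, σ.symm ⟨i, hi⟩))
  rw [Pi.zero_apply] at hxT
  refine Eq.trans ?_ hxT
  rw [Finset.sum_range, Matrix.vecMul, dotProduct, Fintype.sum_prod_type_right,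
    Fintype.sum_prod_type, ← Equiv.sum_comp τ]
  refine Finset.sum_congr rfl fun j' _ => ?_
  have hK (S) (k') : koszulFlattening (2 * m + 1) m π
      (fun a b c => if a = a₀ then 0 else matMulTensor (m + 1) a b c) (S, (j', k'))
      (⟨T, hT⟩, (k, σ.symm ⟨i, hi⟩)) =
      if k' = k ∧ (σ.symm ⟨i, hi⟩, j') ≠ a₀ then
        if i + (τ j' : ℕ) ∈ T ∧ T.erase (i + (τ j' : ℕ)) = S then wedgeSign S (i + (τ j' : ℕ))
        else 0 else 0 := by
    simp only [koszulFlattening, Matrix.of_apply]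
    rw [Finset.sum_eq_single (σ.symm ⟨i, hi⟩, j')]
    · simp only [matMulTensor, π, wedgeEntry_single, Equiv.apply_symm_apply]
      split_ifs <;> simp_all
    · rintro ⟨a1, a2⟩ - ha
      simp only [matMulTensor]
      split_ifs with h1 h2
      · simp
      · exact absurd (Prod.ext h2.2.2.symm h2.1) ha
      · simp
    · simp
  have ha : (σ.symm ⟨i, hi⟩, j') ≠ a₀ ↔ ¬ (i = 0 ∧ (τ j' : ℕ) = m + 1 - 1) := by
    rw [Ne, Prod.ext_iff, Equiv.symm_apply_eq, hσ, ← τ.apply_eq_iff_eq (x := j'), hτ]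
    simp [Fin.ext_iff]
  simp only [hK, ha]
  rw [Finset.sum_eq_single k]
  · by_cases hc : i + (τ j' : ℕ) ∈ T ∧ ¬ (i = 0 ∧ (τ j' : ℕ) = m + 1 - 1)
    · have hE : T.erase (i + (τ j' : ℕ)) ∈
          Finset.powersetCard m (Finset.range (2 * m + 1)) := by
        rw [Finset.mem_powersetCard] at hT ⊢
        refine ⟨(Finset.erase_subset _ _).trans hT.1, ?_⟩
        rw [Finset.card_erase_of_mem hc.1, hT.2]
        rfl
      rw [if_pos hc, Finset.sum_eq_single ⟨_, hE⟩]
      · rw [if_pos ⟨rfl, hc.2⟩, if_pos ⟨hc.1, rfl⟩, mul_comm]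
        simp only [y, dif_pos hE, dif_pos (τ j').2, Fin.eta, Equiv.symm_apply_apply]
      · intro S _ hS'
        have : T.erase (i + (τ j' : ℕ)) ≠ S := fun h => hS' (Subtype.ext h.symm)
        simp [this]
      · simp
    · rw [if_neg hc]
      refine (Finset.sum_eq_zero fun S _ => ?_).symm
      by_cases hc1 : i + (τ j' : ℕ) ∈ T
      · rw [if_neg (by tauto), mul_zero]
      · rw [if_neg (fun h : i + (τ j' : ℕ) ∈ T ∧ _ => hc1 h.1), ite_self, mul_zero]
  · intro k' _ hk'
    simp [hk']
  · simp

end LowerBound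

section Prolongation

open scoped Matrix

variable {Q ιa ιb : Type*}

/-- The matrix whose left kernel consists of the families `κ` of vectors for which
`∑ q, κ q ⊗ e q` is symmetric in its first two arguments. -/
def prolongMatrix [DecidableEq ιa] (e : Q → ιa → ιb → ℂ) : Matrix (Q × ιa) (ιa × ιa × ιb) ℂ :=
  Matrix.of fun x y =>
    (if x.2 = y.1 then e x.1 y.2.1 y.2.2 else 0) - if x.2 = y.2.1 then e x.1 y.1 y.2.2 else 0

theorem vecMul_prolongMatrix [Fintype Q] [Fintype ιa] [DecidableEq ιa] (e : Q → ιa → ιb → ℂ)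
    (κ : Q × ιa → ℂ) (a₁ a₂ : ιa) (b : ιb) :
    (κ ᵥ* prolongMatrix e) (a₁, a₂, b) =
      ∑ q, κ (q, a₁) * e q a₂ b - ∑ q, κ (q, a₂) * e q a₁ b := by
  simp [Matrix.vecMul, dotProduct, prolongMatrix, Fintype.sum_prod_type, mul_sub]

theorem rank_prolongMatrix_add_le [Fintype Q] [Fintype ιa] [Fintype ιb] [DecidableEq ιa] {r : ℕ}
    {u : Fin r → ιa → ℂ} {v : Fin r → ιb → ℂ}
    (hli : LinearIndependent ℂ fun l a b => u l a * v l b) {e : Q → ιa → ιb → ℂ}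
    (he : ∀ l, (fun a b => u l a * v l b) ∈ Submodule.span ℂ (Set.range e)) :
    (prolongMatrix e).rank + r ≤ Fintype.card Q * Fintype.card ιa := by
  classical
  simp only [Submodule.mem_span_range_iff_exists_fun] at he
  choose H hH using he
  have hH' (l a b) : ∑ q, H l q * e q a b = u l a * v l b := by
    have := congrFun (congrFun (hH l) a) b
    simpa using this
  let κ (l : Fin r) : LinearMap.ker (prolongMatrix e).vecMulLinear :=
    ⟨fun x => H l x.1 * u l x.2, by
      rw [LinearMap.mem_ker, Matrix.vecMulLinear_apply]
      ext ⟨a₁, a₂, b⟩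
      rw [vecMul_prolongMatrix]
      simp only [mul_right_comm _ (u l _), ← Finset.sum_mul, hH', Pi.zero_apply]
      ring⟩
  have hκ : LinearIndependent ℂ κ := by
    have hne := hli.ne_zero
    rw [Fintype.linearIndependent_iff] at hli ⊢
    intro c hc
    have hc' (q : Q) (a : ιa) : ∑ l, c l * (H l q * u l a) = 0 := by
      have := congrFun (congrArg Subtype.val hc) (q, a)
      simpa [κ] using this
    have h1 (a : ιa) (l : Fin r) : c l * u l a = 0 := by
      refine hli (fun l => c l * u l a) ?_ l
      ext a' b'
      simp only [Finset.sum_apply, Pi.smul_apply, smul_eq_mul, Pi.zero_apply, ← hH',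
        Finset.mul_sum]
      rw [Finset.sum_comm]
      refine Finset.sum_eq_zero fun q _ => ?_
      have := congrArg (· * e q a' b') (hc' q a)
      simp only [Finset.sum_mul, zero_mul] at this
      rw [← this]
      exact Finset.sum_congr rfl fun l _ => by ring
    intro l
    by_contra hcl
    refine hne l ?_
    ext a b
    simp [(mul_eq_zero.mp (h1 a l)).resolve_left hcl]
  have h := hκ.fintype_card_le_finrank
  rw [Fintype.card_fin] at h
  have h2 := (prolongMatrix e).rank_add_finrank_ker_vecMulLinear
  rw [Fintype.card_prod] at h2
  omega

end Prolongation

section TwoByTwo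

open Polynomial
open scoped Matrix

theorem exists_eq_smul_of_finrank_le_two {D : Submodule ℂ (Fin 2 → ℂ[X])} [Module.Finite ℂ D]
    (hD : Module.finrank ℂ D ≤ 2) {d d' : Fin 2 → ℂ[X]} (hd : d ≠ 0) (h1 : d ∈ D)
    (h2 : (X : ℂ[X]) • d ∈ D) (h1' : d' ∈ D) (h2' : (X : ℂ[X]) • d' ∈ D) :
    ∃ a : ℂ, d' = a • d := by
  obtain ⟨k, hk⟩ := Function.ne_iff.mp hd
  have key (a b c : ℂ) (h : (C a + C b * X + C c * X ^ 2) * d k = 0) : a = 0 ∧ b = 0 ∧ c = 0 := by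
    have h := (mul_eq_zero.mp h).resolve_right hk
    have h0 := congrArg (coeff · 0) h
    have h1 := congrArg (coeff · 1) h
    have h2 := congrArg (coeff · 2) h
    simp [coeff_X, coeff_C] at h0 h1 h2
    exact ⟨h0, h1, h2⟩
  have hli : LinearIndependent ℂ ![d, (X : ℂ[X]) • d] := by
    rw [LinearIndependent.pair_iff]
    intro a b h
    have := congrFun h k
    simp only [Pi.add_apply, Pi.smul_apply, smul_eq_mul, smul_eq_C_mul, Pi.zero_apply] at this
    obtain ⟨ha, hb, -⟩ := key a b 0 (by rw [← this]; simp; ring)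
    exact ⟨ha, hb⟩
  have hspan : Submodule.span ℂ {d, (X : ℂ[X]) • d} = D := by
    refine Submodule.eq_of_le_of_finrank_le ?_ (hD.trans ?_)
    · rw [Submodule.span_le]
      rintro _ (rfl | rfl)
      exacts [h1, h2]
    · have := finrank_span_eq_card hli
      rw [Matrix.range_cons, Matrix.range_cons, Matrix.range_empty, Set.union_empty,
        Set.singleton_union, Fintype.card_fin] at this
      exact this.ge
  rw [← hspan, Submodule.mem_span_pair] at h1' h2'
  obtain ⟨a, b, rfl⟩ := h1'
  obtain ⟨a', b', h⟩ := h2'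
  have := congrFun h k
  simp only [Pi.add_apply, Pi.smul_apply, smul_eq_mul, smul_eq_C_mul] at this
  obtain ⟨-, -, hb⟩ := key (-a') (a - b') b (by
    simp only [map_neg, map_sub]
    linear_combination -this)
  exact ⟨a, by simp [hb]⟩

/-- The coefficients of the quadratic polynomial attached to each `2 × 2` block of a form. -/
def blockCoeff (y : Fin 2 × Fin 2 → Fin 2 × Fin 2 → ℂ) (z k : Fin 2) : Fin 3 → ℂ :=
  ![y (z, 0) (1, k), y (z, 1) (1, k) - y (z, 0) (0, k), -y (z, 1) (0, k)]

/-- The quadratic polynomial attached to each `2 × 2` block of a form. -/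
noncomputable def blockPoly (y : Fin 2 × Fin 2 → Fin 2 × Fin 2 → ℂ) (z k : Fin 2) : ℂ[X] :=
  ∑ s, C (blockCoeff y z k s) * X ^ (s : ℕ)

theorem coeff_blockPoly (y : Fin 2 × Fin 2 → Fin 2 × Fin 2 → ℂ) (z k : Fin 2) (s : Fin 3) :
    (blockPoly y z k).coeff s = blockCoeff y z k s := by
  simp [blockPoly, coeff_X_pow, ← Fin.ext_iff]

/-- The slices of a tensor in its third direction, together with two more forms. -/
def adjoinForms (T : Fin 2 × Fin 2 → Fin 2 × Fin 2 → Fin 2 × Fin 2 → ℂ)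
    (x : Fin 2 → Fin 2 × Fin 2 → Fin 2 × Fin 2 → ℂ) :
    (Fin 2 × Fin 2) ⊕ Fin 2 → Fin 2 × Fin 2 → Fin 2 × Fin 2 → ℂ :=
  Sum.elim (fun c a b => T a b c) x

/-- Transposition of forms, compatible with `(X Y)ᵀ = Yᵀ Xᵀ`. -/
def transposeForm (y : Fin 2 × Fin 2 → Fin 2 × Fin 2 → ℂ) : Fin 2 × Fin 2 → Fin 2 × Fin 2 → ℂ :=
  fun a b => y b.swap a.swap

theorem blockCoeff_transposeForm (y : Fin 2 × Fin 2 → Fin 2 × Fin 2 → ℂ) (z k : Fin 2)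
    (s : Fin 3) : blockCoeff y z k s =
      (if s = 1 then 1 else -1) * blockCoeff (transposeForm y) k z s.rev := by
  fin_cases s <;> simp [blockCoeff, transposeForm]

/-- The pairing of vectors with forms obtained by contracting the symmetry condition. -/
noncomputable def blockPairing (x : Fin 2 → Fin 2 × Fin 2 → Fin 2 × Fin 2 → ℂ) :
    (Fin 2 × (Fin 2 × Fin 2) → ℂ) →ₗ[ℂ] (Fin 2 → ℂ[X]) where
  toFun f k := ∑ i, ((C (f (i, (0, 0))) + C (f (i, (0, 1))) * X) * blockPoly (x i) 1 k -
    (C (f (i, (1, 0))) + C (f (i, (1, 1))) * X) * blockPoly (x i) 0 k)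
  map_add' f g := by
    ext1 k
    simp only [Pi.add_apply, map_add, ← Finset.sum_add_distrib]
    exact Finset.sum_congr rfl fun i _ => by ring
  map_smul' c f := by
    ext1 k
    simp only [Pi.smul_apply, smul_eq_mul, map_mul, smul_eq_C_mul, Finset.mul_sum,
      RingHom.id_apply]
    exact Finset.sum_congr rfl fun i _ => by ring

theorem symm_of_mem_ker_prolongMatrix {x : Fin 2 → Fin 2 × Fin 2 → Fin 2 × Fin 2 → ℂ}
    {κ : ((Fin 2 × Fin 2) ⊕ Fin 2) × (Fin 2 × Fin 2) → ℂ}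
    (hκ : κ ᵥ* prolongMatrix (adjoinForms (matMulTensor 2) x) = 0) (a₁ a₂ b : Fin 2 × Fin 2) :
    (if a₂.2 = b.1 then κ (.inl (b.2, a₂.1), a₁) else 0) + ∑ i, κ (.inr i, a₁) * x i a₂ b =
      (if a₁.2 = b.1 then κ (.inl (b.2, a₁.1), a₂) else 0) + ∑ i, κ (.inr i, a₂) * x i a₁ b := by
  have h := congrFun hκ (a₁, a₂, b)
  rw [vecMul_prolongMatrix, Pi.zero_apply, sub_eq_zero, Fintype.sum_sum_type,
    Fintype.sum_sum_type] at h
  have hM (a a' : Fin 2 × Fin 2) :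
      ∑ c, κ (.inl c, a) * adjoinForms (matMulTensor 2) x (.inl c) a' b =
        if a'.2 = b.1 then κ (.inl (b.2, a'.1), a) else 0 := by
    rw [Finset.sum_eq_single (b.2, a'.1)]
    · simp [adjoinForms, matMulTensor]
    · rintro ⟨c1, c2⟩ - hc
      have : ¬ (a'.2 = b.1 ∧ b.2 = c1 ∧ c2 = a'.1) :=
        fun h => hc (Prod.ext h.2.1.symm h.2.2)
      simp [adjoinForms, matMulTensor, this]
    · simp
  rwa [hM, hM] at h

theorem blockPairing_eq_zero_of_mem_ker {x : Fin 2 → Fin 2 × Fin 2 → Fin 2 × Fin 2 → ℂ}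
    {κ : ((Fin 2 × Fin 2) ⊕ Fin 2) × (Fin 2 × Fin 2) → ℂ}
    (hκ : κ ᵥ* prolongMatrix (adjoinForms (matMulTensor 2) x) = 0) :
    blockPairing x (fun p => κ (.inr p.1, p.2)) = 0 := by
  ext1 k
  have h (j₁ j₂ j' : Fin 2) := congrArg C
    (symm_of_mem_ker_prolongMatrix hκ (0, j₁) (1, j₂) (j', k))
  have h000 := h 0 0 0
  have h001 := h 0 0 1
  have h010 := h 0 1 0
  have h011 := h 0 1 1
  have h100 := h 1 0 0
  have h101 := h 1 0 1
  have h110 := h 1 1 0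
  have h111 := h 1 1 1
  simp only [Fin.sum_univ_two, map_add, map_mul, if_true, zero_ne_one, one_ne_zero, if_false,
    map_zero] at h000 h001 h010 h011 h100 h101 h110 h111
  simp only [blockPairing, blockPoly, blockCoeff, Fin.sum_univ_two, Fin.sum_univ_three,
    LinearMap.coe_mk, AddHom.coe_mk, Pi.zero_apply]
  simp only [Matrix.cons_val, map_sub, map_neg, Fin.val_zero, Fin.val_one, Fin.val_two, pow_zero]
  linear_combination -X * h000 + h001 - X ^ 2 * h010 + X * h011 - X ^ 2 * h100 + X * h101
    - X ^ 3 * h110 + X ^ 2 * h111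

theorem finrank_range_blockPairing_le {x : Fin 2 → Fin 2 × Fin 2 → Fin 2 × Fin 2 → ℂ}
    (h : (prolongMatrix (adjoinForms (matMulTensor 2) x)).rank ≤ 18) :
    Module.finrank ℂ (LinearMap.range (blockPairing x)) ≤ 2 := by
  let N := prolongMatrix (adjoinForms (matMulTensor 2) x)
  let ψ : LinearMap.ker N.vecMulLinear →ₗ[ℂ] LinearMap.ker (blockPairing x) :=
    ((LinearMap.funLeft ℂ ℂ fun p : Fin 2 × (Fin 2 × Fin 2) => (Sum.inr p.1, p.2)).comp
      (LinearMap.ker N.vecMulLinear).subtype).codRestrict _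
      fun κ => blockPairing_eq_zero_of_mem_ker κ.2
  have hψ : Function.Injective ψ := by
    rw [← LinearMap.ker_eq_bot, LinearMap.ker_eq_bot']
    rintro ⟨κ, hκ⟩ h0
    have h0 (i a) : κ (.inr i, a) = 0 := congrFun (congrArg Subtype.val h0) (i, a)
    ext ⟨c | i, a⟩
    · obtain ⟨j, hj⟩ : ∃ j : Fin 2, a.2 ≠ j := ⟨a.2 + 1, by generalize a.2 = t; revert t; decide⟩
      have := symm_of_mem_ker_prolongMatrix hκ a (c.2, j) (j, c.1)
      simpa [h0, hj] using this
    · exact h0 i a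
  have h1 := LinearMap.finrank_le_finrank_of_injective hψ
  have h2 := N.rank_add_finrank_ker_vecMulLinear
  have h3 := LinearMap.finrank_range_add_finrank_ker (blockPairing x)
  simp only [Fintype.card_prod, Fintype.card_sum, Fintype.card_fin,
    Module.finrank_fintype_fun_eq_card] at h2 h3
  change N.rank ≤ 18 at h
  omega

theorem exists_blockCoeff_eq_mul {x : Fin 2 → Fin 2 × Fin 2 → Fin 2 × Fin 2 → ℂ}
    (h : (prolongMatrix (adjoinForms (matMulTensor 2) x)).rank ≤ 18) :
    ∃ (γ : Fin 2 → Fin 2 → ℂ) (δ : Fin 2 → Fin 3 → ℂ),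
      ∀ i z k s, blockCoeff (x i) z k s = γ i z * δ k s := by
  have hD := finrank_range_blockPairing_le h
  have hmem (i z : Fin 2) : blockPoly (x i) z ∈ LinearMap.range (blockPairing x) ∧
      (X : ℂ[X]) • blockPoly (x i) z ∈ LinearMap.range (blockPairing x) := by
    refine ⟨⟨(if z = 0 then -1 else 1 : ℂ) • Pi.single (i, (z + 1, 0)) 1, ?_⟩,
      ⟨(if z = 0 then -1 else 1 : ℂ) • Pi.single (i, (z + 1, 1)) 1, ?_⟩⟩ <;>
    · ext1 k
      fin_cases i <;> fin_cases z <;> simp [blockPairing]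
  by_cases h0 : ∀ i z, blockPoly (x i) z = 0
  · refine ⟨0, 0, fun i z k s => ?_⟩
    rw [← coeff_blockPoly, h0]
    simp
  push Not at h0
  obtain ⟨i₀, z₀, h0⟩ := h0
  choose γ hγ using fun i z => exists_eq_smul_of_finrank_le_two hD h0 (hmem i₀ z₀).1
    (hmem i₀ z₀).2 (hmem i z).1 (hmem i z).2
  refine ⟨γ, fun k s => (blockPoly (x i₀) z₀ k).coeff s, fun i z k s => ?_⟩
  rw [← coeff_blockPoly, hγ]
  simp

/-- No two forms can be added to the slices of `M_⟨2⟩` with both prolongations degenerate. -/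
theorem not_rank_prolongMatrix_le {x : Fin 2 → Fin 2 × Fin 2 → Fin 2 × Fin 2 → ℂ}
    (hx : LinearIndependent ℂ x) (hρ : ∀ i j k, x i (j, 0) (0, k) = 0)
    (h : (prolongMatrix (adjoinForms (matMulTensor 2) x)).rank ≤ 18)
    (h' : (prolongMatrix
      (adjoinForms (matMulTensor 2) fun i => transposeForm (x i))).rank ≤ 18) : False := by
  obtain ⟨γ, δ, hγ⟩ := exists_blockCoeff_eq_mul h
  obtain ⟨γ', δ', hγ'⟩ := exists_blockCoeff_eq_mul h'
  rw [Fintype.linearIndependent_iff] at hx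
  have hinj (g : Fin 2 → ℂ) (hg : ∀ z k s, ∑ i, g i * blockCoeff (x i) z k s = 0) : g = 0 := by
    refine funext (hx g ?_)
    ext ⟨z, j⟩ ⟨j', k⟩
    have h0 := hg z k 0
    have h1 := hg z k 1
    have h2 := hg z k 2
    simp only [blockCoeff, Fin.sum_univ_two, Matrix.cons_val, hρ, sub_zero] at h0 h1 h2
    simp only [Finset.sum_apply, Pi.smul_apply, smul_eq_mul, Fin.sum_univ_two, Pi.zero_apply]
    fin_cases j <;> fin_cases j'
    · simp [hρ]
    · exact h0
    · simp only [Fin.mk_one, Fin.zero_eta]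
      linear_combination -h2
    · exact h1
  have hdet (k : Fin 2) (s : Fin 3) : (γ 0 0 * γ 1 1 - γ 0 1 * γ 1 0) * δ k s ^ 2 = 0 := by
    have h (i z : Fin 2) : γ i z * δ k s =
        (if s = 1 then 1 else -1) * (γ' i k * δ' z s.rev) := by
      rw [← hγ, blockCoeff_transposeForm, hγ']
    linear_combination γ 1 1 * δ k s * h 0 0 + (if s = 1 then 1 else -1) * (γ' 0 k * δ' 0 s.rev) *
      h 1 1 - γ 1 0 * δ k s * h 0 1 - (if s = 1 then 1 else -1) * (γ' 0 k * δ' 1 s.rev) * h 1 0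
  by_cases hγ0 : (Matrix.of γ).det = 0
  · obtain ⟨g, hg0, hg⟩ := Matrix.exists_vecMul_eq_zero_iff.mpr hγ0
    refine hg0 (hinj g fun z k s => ?_)
    have := congrFun hg z
    simp only [Matrix.vecMul, dotProduct, Matrix.of_apply, Pi.zero_apply] at this
    simp only [hγ, ← mul_assoc, ← Finset.sum_mul, this, zero_mul]
  · rw [Matrix.det_fin_two] at hγ0
    have hδ (k s) : δ k s = 0 := by
      simpa using (mul_eq_zero.mp (hdet k s)).resolve_left hγ0
    have := congrFun (hinj 1 fun z k s => by simp [hγ, hδ]) 0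
    simp at this

end TwoByTwo

section OrthonormalPairs

variable {ιa ιb : Type*} [Fintype ιa] [Fintype ιb]

/-- Pairs of forms that are orthonormal for the standard Hermitian inner product. -/
def orthonormalPairs (ιa ιb : Type*) [Fintype ιa] [Fintype ιb] : Set (Fin 2 → ιa → ιb → ℂ) :=
  {x | ∀ i j, ∑ a, ∑ b, star (x i a b) * x j a b = if i = j then 1 else 0}

theorem isCompact_orthonormalPairs : IsCompact (orthonormalPairs ιa ιb) := by
  refine (isCompact_closedBall (0 : Fin 2 → ιa → ιb → ℂ) 1).of_isClosed_subset ?_ fun x hx => ?_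
  · have : orthonormalPairs ιa ιb = ⋂ i, ⋂ j,
        {x | ∑ a, ∑ b, star (x i a b) * x j a b = if i = j then 1 else 0} := by
      ext; simp [orthonormalPairs]
    rw [this]
    exact isClosed_iInter fun i => isClosed_iInter fun j =>
      isClosed_eq (by fun_prop) continuous_const
  · rw [mem_closedBall_zero_iff]
    refine (pi_norm_le_iff_of_nonneg zero_le_one).mpr fun i =>
      (pi_norm_le_iff_of_nonneg zero_le_one).mpr fun a =>
      (pi_norm_le_iff_of_nonneg zero_le_one).mpr fun b => ?_
    have h : ∑ a, ∑ b, ‖x i a b‖ ^ 2 = 1 := by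
      have := hx i i
      simp only [if_true, Complex.star_def, Complex.conj_mul'] at this
      exact_mod_cast this
    have h1 : ‖x i a b‖ ^ 2 ≤ 1 := by
      rw [← h]
      refine (Finset.single_le_sum (f := fun b => ‖x i a b‖ ^ 2) (fun _ _ => sq_nonneg _)
        (Finset.mem_univ b)).trans ?_
      exact Finset.single_le_sum (f := fun a => ∑ b, ‖x i a b‖ ^ 2)
        (fun _ _ => Finset.sum_nonneg fun _ _ => sq_nonneg _) (Finset.mem_univ a)
    exact (sq_le_one_iff₀ (norm_nonneg _)).mp h1

theorem linearIndependent_of_mem_orthonormalPairs {x : Fin 2 → ιa → ιb → ℂ}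
    (hx : x ∈ orthonormalPairs ιa ιb) : LinearIndependent ℂ x := by
  rw [Fintype.linearIndependent_iff]
  intro g hg i
  have h1 : ∑ a, ∑ b, star (x i a b) * ∑ j, g j * x j a b = 0 := by
    refine Finset.sum_eq_zero fun a _ => Finset.sum_eq_zero fun b _ => ?_
    have := congrFun (congrFun hg a) b
    simp only [Finset.sum_apply, Pi.smul_apply, smul_eq_mul, Pi.zero_apply] at this
    rw [this, mul_zero]
  have h2 : ∑ j, g j * ∑ a, ∑ b, star (x i a b) * x j a b = 0 := by
    rw [← h1]
    simp only [Finset.mul_sum]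
    rw [Finset.sum_comm]
    refine Finset.sum_congr rfl fun a _ => ?_
    rw [Finset.sum_comm]
    exact Finset.sum_congr rfl fun b _ => Finset.sum_congr rfl fun j _ => by ring
  have hx' := hx i
  simpa only [hx', mul_ite, mul_one, mul_zero, Finset.sum_ite_eq, Finset.mem_univ,
    if_true] using h2

theorem exists_mem_orthonormalPairs {W : Submodule ℂ (ιa → ιb → ℂ)}
    (hW : 2 ≤ Module.finrank ℂ W) : ∃ x ∈ orthonormalPairs ιa ιb, ∀ i, x i ∈ W := by
  let e : EuclideanSpace ℂ (ιa × ιb) ≃ₗ[ℂ] (ιa → ιb → ℂ) :=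
    (WithLp.linearEquiv 2 ℂ (ιa × ιb → ℂ)).trans (LinearEquiv.curry ℂ ℂ ιa ιb)
  let W' := W.comap e.toLinearMap
  have hW' : Module.finrank ℂ W' = Module.finrank ℂ W :=
    (e.ofSubmodule' W).finrank_eq
  let B := stdOrthonormalBasis ℂ W'
  let ι (i : Fin 2) : Fin (Module.finrank ℂ W') := Fin.castLE (hW.trans_eq hW'.symm) i
  refine ⟨fun i => e (B (ι i)), fun i j => ?_, fun i => (B (ι i)).2⟩
  have h := orthonormal_iff_ite.mp B.orthonormal (ι i) (ι j)
  rw [Submodule.coe_inner, PiLp.inner_apply, Fintype.sum_prod_type] at h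
  simp only [(Fin.castLE_injective (hW.trans_eq hW'.symm)).eq_iff, ι] at h
  rw [← h]
  refine Finset.sum_congr rfl fun a _ => Finset.sum_congr rfl fun b _ => ?_
  simp [e, ι, mul_comm]

end OrthonormalPairs

theorem linearIndependent_of_not_tensorRankLE {ιa ιb ιc : Type*} {r : ℕ}
    {T : ιa → ιb → ιc → ℂ} {u : Fin (r + 1) → ιa → ℂ} {v : Fin (r + 1) → ιb → ℂ}
    {w : Fin (r + 1) → ιc → ℂ} (h : ∀ i j k, T i j k = ∑ l, u l i * v l j * w l k)
    (hT : ¬ tensorRankLE r T) : LinearIndependent ℂ fun l a b => u l a * v l b := by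
  by_contra hli
  obtain ⟨g, hg, i, hi⟩ := Fintype.not_linearIndependent_iff.mp hli
  refine hT ⟨fun l => u (i.succAbove l), fun l => v (i.succAbove l),
    fun l c => w (i.succAbove l) c - g (i.succAbove l) / g i * w i c, fun a b c => ?_⟩
  have hab := congrFun (congrFun hg a) b
  simp only [Finset.sum_apply, Pi.smul_apply, smul_eq_mul, Pi.zero_apply] at hab
  rw [Fin.sum_univ_succAbove _ i] at hab
  have huv : u i a * v i b =
      -∑ l, g (i.succAbove l) * (u (i.succAbove l) a * v (i.succAbove l) b) / g i := by
    rw [← Finset.sum_div, ← neg_div, eq_div_iff hi]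
    linear_combination hab
  rw [h, Fin.sum_univ_succAbove _ i, huv, neg_mul, Finset.sum_mul, ← sub_eq_neg_add,
    ← Finset.sum_sub_distrib]
  exact Finset.sum_congr rfl fun l _ => by ring

section Limit

/-- Transposition of tensors, fixing the matrix multiplication tensor. -/
def transposeTensor (T : Fin 2 × Fin 2 → Fin 2 × Fin 2 → Fin 2 × Fin 2 → ℂ) :
    Fin 2 × Fin 2 → Fin 2 × Fin 2 → Fin 2 × Fin 2 → ℂ :=
  fun a b c => T b.swap a.swap c.swap

theorem transposeTensor_matMulTensor : transposeTensor (matMulTensor 2) = matMulTensor 2 := by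
  ext a b c
  simp only [transposeTensor, matMulTensor, Prod.fst_swap, Prod.snd_swap]
  refine if_congr ?_ rfl rfl
  constructor <;> rintro ⟨h1, h2, h3⟩ <;> exact ⟨h1.symm, h3.symm, h2.symm⟩

/-- The block of each slice of `T` that is nondegenerate for the matrix multiplication tensor. -/
def cornerMatrix (T : Fin 2 × Fin 2 → Fin 2 × Fin 2 → Fin 2 × Fin 2 → ℂ) :
    Matrix (Fin 2 × Fin 2) (Fin 2 × Fin 2) ℂ :=
  Matrix.of fun c p => T (p.2, 0) (0, p.1) c

theorem cornerMatrix_matMulTensor : cornerMatrix (matMulTensor 2) = 1 := by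
  ext c p
  simp only [cornerMatrix, matMulTensor, Matrix.of_apply, Matrix.one_apply, Prod.ext_iff, true_and]
  exact if_congr (by simp [eq_comm]) rfl rfl

theorem span_adjoinForms_eq {T : Fin 2 × Fin 2 → Fin 2 × Fin 2 → Fin 2 × Fin 2 → ℂ}
    (hdet : (cornerMatrix T).det ≠ 0) {x : Fin 2 → Fin 2 × Fin 2 → Fin 2 × Fin 2 → ℂ}
    (hx : LinearIndependent ℂ x) (hρ : ∀ i j k, x i (j, 0) (0, k) = 0)
    {E : Submodule ℂ (Fin 2 × Fin 2 → Fin 2 × Fin 2 → ℂ)} (hE : Module.finrank ℂ E = 6)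
    (hxE : ∀ i, x i ∈ E) (hTE : ∀ c, (fun a b => T a b c) ∈ E) :
    Submodule.span ℂ (Set.range (adjoinForms T x)) = E := by
  have hli : LinearIndependent ℂ (adjoinForms T x) := by
    rw [Fintype.linearIndependent_iff] at hx ⊢
    intro g hg
    rw [Fintype.sum_sum_type] at hg
    have hl : (fun c => g (.inl c)) = 0 := by
      refine Matrix.eq_zero_of_vecMul_eq_zero hdet ?_
      ext ⟨k, j⟩
      have := congrFun (congrFun hg (j, 0)) (0, k)
      simpa [adjoinForms, hρ, Matrix.vecMul, dotProduct, cornerMatrix] using this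
    have hr := hx (fun i => g (.inr i)) (by
      simpa [fun c => congrFun hl c, adjoinForms] using hg)
    rintro (c | i)
    exacts [congrFun hl c, hr i]
  refine Submodule.eq_of_le_of_finrank_eq ?_ ?_
  · rw [Submodule.span_le]
    rintro _ ⟨c | i, rfl⟩
    exacts [hTE c, hxE i]
  · rw [hE, finrank_span_eq_card hli]
    simp

theorem exists_orthonormalPair_rank_le
    {T : Fin 2 × Fin 2 → Fin 2 × Fin 2 → Fin 2 × Fin 2 → ℂ} (h6 : tensorRankLE 6 T)
    (h5 : ¬ tensorRankLE 5 T) (hdet : (cornerMatrix T).det ≠ 0) :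
    ∃ x ∈ orthonormalPairs (Fin 2 × Fin 2) (Fin 2 × Fin 2), (∀ i j k, x i (j, 0) (0, k) = 0) ∧
      (prolongMatrix (adjoinForms T x)).rank ≤ 18 ∧
      (prolongMatrix (adjoinForms (transposeTensor T) fun i => transposeForm (x i))).rank ≤ 18 := by
  obtain ⟨u, v, w, h⟩ := h6
  have hli := linearIndependent_of_not_tensorRankLE h h5
  let E := Submodule.span ℂ (Set.range fun l a b => u l a * v l b)
  have hE : Module.finrank ℂ E = 6 := finrank_span_eq_card hli
  have hTE (c) : (fun a b => T a b c) ∈ E := by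
    have : (fun a b => T a b c) = ∑ l, w l c • fun a b => u l a * v l b := by
      ext a b
      simp [h, mul_comm]
    rw [this]
    exact Submodule.sum_mem _ fun l _ => Submodule.smul_mem _ _ (Submodule.subset_span ⟨l, rfl⟩)
  let ρ : (Fin 2 × Fin 2 → Fin 2 × Fin 2 → ℂ) →ₗ[ℂ] (Fin 2 × Fin 2 → ℂ) :=
    { toFun := fun y p => y (p.1, 0) (0, p.2)
      map_add' := fun _ _ => rfl
      map_smul' := fun _ _ => rfl }
  have hW : 2 ≤ Module.finrank ℂ (E ⊓ LinearMap.ker ρ : Submodule ℂ _) := by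
    have h1 := LinearMap.finrank_range_add_finrank_ker (ρ.domRestrict E)
    have h2 := Submodule.finrank_le (LinearMap.range (ρ.domRestrict E))
    have h3 : Module.finrank ℂ (LinearMap.ker (ρ.domRestrict E)) =
        Module.finrank ℂ (E ⊓ LinearMap.ker ρ : Submodule ℂ _) := by
      rw [LinearMap.ker_domRestrict, ← Submodule.map_comap_subtype]
      exact (Submodule.equivMapOfInjective _ E.injective_subtype _).finrank_eq
    rw [Module.finrank_fintype_fun_eq_card, Fintype.card_prod, Fintype.card_fin] at h2
    omega
  obtain ⟨x, hx, hxW⟩ := exists_mem_orthonormalPairs hW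
  have hρ (i j k) : x i (j, 0) (0, k) = 0 := congrFun (hxW i).2 (j, k)
  have hspan := span_adjoinForms_eq hdet (linearIndependent_of_mem_orthonormalPairs hx) hρ hE
    (fun i => (hxW i).1) hTE
  let τ : (Fin 2 × Fin 2 → Fin 2 × Fin 2 → ℂ) →ₗ[ℂ] (Fin 2 × Fin 2 → Fin 2 × Fin 2 → ℂ) :=
    { toFun := transposeForm
      map_add' := fun _ _ => rfl
      map_smul' := fun _ _ => rfl }
  have hτ : LinearMap.ker τ = ⊥ := by
    rw [LinearMap.ker_eq_bot']
    intro y hy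
    ext a b
    exact congrFun (congrFun hy b.swap) a.swap
  have hmem (l) : (fun a b => u l a * v l b) ∈ Submodule.span ℂ (Set.range (adjoinForms T x)) :=
    hspan ▸ Submodule.subset_span ⟨l, rfl⟩
  refine ⟨x, hx, hρ, ?_, ?_⟩
  · have := rank_prolongMatrix_add_le hli hmem
    simpa using this
  · have hli' : LinearIndependent ℂ fun l (a b : Fin 2 × Fin 2) => v l a.swap * u l b.swap := by
      have h := hli.map' τ hτ
      have hτuv : (τ ∘ fun l a b => u l a * v l b) = fun l a b => v l a.swap * u l b.swap := by
        ext l a b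
        exact mul_comm _ _
      rwa [hτuv] at h
    have := rank_prolongMatrix_add_le hli' (e := adjoinForms (transposeTensor T)
      fun i => transposeForm (x i)) fun l => by
        have := Submodule.mem_map_of_mem (f := τ) (hmem l)
        rw [Submodule.map_span] at this
        convert Submodule.span_mono ?_ this using 1
        · ext a b
          exact mul_comm _ _
        · rintro _ ⟨_, ⟨c | i, rfl⟩, rfl⟩
          · exact ⟨.inl c.swap, rfl⟩
          · exact ⟨.inr i, rfl⟩
    simpa using this

theorem not_borderRankLE_matMulTensor_two : ¬ borderRankLE 6 (matMulTensor 2) := by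
  intro h6
  have h5 : ¬ borderRankLE 5 (matMulTensor 2) := fun h => by
    have := mul_choose_le_of_borderRankLE_matMulTensor (m := 1) h
    simp at this
  let F : Set ((Fin 2 × Fin 2 → Fin 2 × Fin 2 → Fin 2 × Fin 2 → ℂ) ×
      (Fin 2 → Fin 2 × Fin 2 → Fin 2 × Fin 2 → ℂ)) :=
    (⋂ i, ⋂ j, ⋂ k, {y | y.2 i (j, 0) (0, k) = 0}) ∩
      ({y | (prolongMatrix (adjoinForms y.1 y.2)).rank ≤ 18} ∩
      {y | (prolongMatrix (adjoinForms (transposeTensor y.1) fun i =>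
        transposeForm (y.2 i))).rank ≤ 18})
  have hF : IsClosed F := by
    refine (isClosed_iInter fun i => isClosed_iInter fun j => isClosed_iInter fun k =>
      isClosed_eq (by fun_prop) continuous_const).inter
      (((isClosed_setOf_rank_le 18).preimage ?_).inter ((isClosed_setOf_rank_le 18).preimage ?_))
    all_goals
      refine continuous_matrix fun ⟨q, a⟩ y => ?_
      rcases q with c | i <;>
      · simp only [prolongMatrix, adjoinForms, transposeTensor, transposeForm, Matrix.of_apply,
          Sum.elim_inl, Sum.elim_inr]
        refine Continuous.sub ?_ ?_ <;> split_ifs <;> fun_prop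
  let U : Set (Fin 2 × Fin 2 → Fin 2 × Fin 2 → Fin 2 × Fin 2 → ℂ) :=
    {T | ¬ borderRankLE 5 T} ∩ {T | (cornerMatrix T).det ≠ 0}
  have hU : IsOpen U := by
    refine isClosed_closure.isOpen_compl.inter (isOpen_ne_fun (Continuous.matrix_det ?_)
      continuous_const)
    refine continuous_matrix fun c p => ?_
    simp only [cornerMatrix, Matrix.of_apply]
    fun_prop
  have hMU : matMulTensor 2 ∈ U := ⟨h5, by simp [cornerMatrix_matMulTensor]⟩
  have hsub : U ∩ {T | tensorRankLE 6 T} ⊆ {T | ∃ x ∈ orthonormalPairs _ _, (T, x) ∈ F} := by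
    rintro T ⟨⟨hT5, hTdet⟩, hT6⟩
    obtain ⟨x, hx, h1, h2, h3⟩ :=
      exists_orthonormalPair_rank_le hT6 (fun h => hT5 (subset_closure h)) hTdet
    exact ⟨x, hx, Set.mem_iInter.mpr fun i => Set.mem_iInter.mpr fun j => Set.mem_iInter.mpr fun k =>
      h1 i j k, h2, h3⟩
  obtain ⟨x, hx, hxF⟩ := closure_minimal hsub
    (isClosed_exists_mem_of_isCompact isCompact_orthonormalPairs hF)
    (hU.inter_closure ⟨hMU, h6⟩)
  obtain ⟨h1, h2, h3⟩ := hxF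
  simp only [Set.mem_iInter, Set.mem_ofPred_eq] at h1 h2 h3
  rw [transposeTensor_matMulTensor] at h3
  exact not_rank_prolongMatrix_le (linearIndependent_of_mem_orthonormalPairs hx) h1 h2 h3

end Limit

section Conclusion

theorem not_borderRankLE_matMulTensor {m : ℕ} (hm : 2 ≤ m) :
    ¬ borderRankLE (2 * (m + 1) ^ 2 - (m + 1)) (matMulTensor (m + 1)) := by
  intro h
  have hr : 2 * (m + 1) ^ 2 - (m + 1) = (2 * m ^ 2 + 3 * m) + 1 := by
    rw [Nat.sub_eq_iff_eq_add (by nlinarith)]; ring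
  rw [hr] at h
  have h1 := mul_choose_le_of_borderRankLE_matMulTensor h
  have h2 : (2 * m + 1).choose m * (m + 1) = (2 * m + 1) * (2 * m).choose m := by
    have := Nat.add_one_mul_choose_eq (2 * m) m
    rw [Nat.choose_symm_half] at this
    exact this.symm
  have h3 : 2 * m ≤ (2 * m).choose m := by
    have := Nat.choose_le_middle 1 (2 * m)
    rwa [Nat.choose_one_right, Nat.mul_div_cancel_left _ two_pos] at this
  nlinarith

theorem borderRankLE_borderRank {ιa ιb ιc : Type*} [Fintype ιa] [Fintype ιb]
    (T : ιa → ιb → ιc → ℂ) : borderRankLE (borderRank T) T := by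
  classical
  refine Nat.sInf_mem (s := {r | borderRankLE r T}) ⟨Fintype.card (ιa × ιb), subset_closure ?_⟩
  let e := (Fintype.equivFin (ιa × ιb)).symm
  refine ⟨fun l => Pi.single (e l).1 1, fun l => Pi.single (e l).2 1, fun l => T (e l).1 (e l).2,
    fun a b c => ?_⟩
  rw [e.sum_comp fun x => (Pi.single x.1 1 : ιa → ℂ) a * (Pi.single x.2 1 : ιb → ℂ) b * T x.1 x.2 c,
    Finset.sum_eq_single (a, b)]
  · simp
  · rintro ⟨a', b'⟩ - h
    by_cases ha : a = a'
    · subst ha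
      have : b ≠ b' := fun hb => h (by rw [hb])
      simp [this]
    · simp [ha]
  · simp

end Conclusion

/-- Lower bound for the border rank of matrix multiplication:
for `n ≥ 2`, `R̲(M_⟨n⟩) ≥ 2n² − n + 1`. -/
theorem stmt4 (n : ℕ) (hn : 2 ≤ n) :
    2 * n ^ 2 - n + 1 ≤ borderRank (matMulTensor n) := by
  by_contra hlt
  have h := (borderRankLE_borderRank (matMulTensor n)).mono
    (show borderRank (matMulTensor n) ≤ 2 * n ^ 2 - n by omega)
  obtain rfl | hn := hn.eq_or_lt
  · exact not_borderRankLE_matMulTensor_two h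
  · obtain ⟨m, rfl⟩ : ∃ m, n = m + 1 := ⟨n - 1, by omega⟩
    exact not_borderRankLE_matMulTensor (by omega) h
end

section
/- Let n ≥ 1. Consider the linear map Φ from the space with basis {e_S ⊗ v_k : S ⊂ [2n−1], |S| = n−1, k ∈ [n]} to the space with basis {e_P ⊗ u_m : P ⊂ [2n−1], |P| = n, m ∈ [n]}, defined by Φ(e_S ⊗ v_k) = Σ_{m ∈ [n], (m,k) ≠ (n,1)} e_{m+k−1} ∧ e_S ⊗ u_m. Then the rank of Φ equals n·C(2n−1, n) − 1, i.e., Φ is surjective onto the hyperplane complementary to the basis vector e_{[n]} ⊗ u_n. -/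
open scoped BigOperators

/-- The matrix (in the bases `e_S ⊗ v_k`, `e_P ⊗ u_m`) of the restricted Koszul flattening
`Φ = (M^red_⟨1,1,n⟩)^{∧(n−1)}_{A'} : Λ^{n−1}ℂ^{2n−1} ⊗ ℂ^n → Λ^n ℂ^{2n−1} ⊗ ℂ^n`,
`Φ(e_S ⊗ v_k) = ∑_{m, (m,k) ≠ (n,1)} e_{m+k−1} ∧ e_S ⊗ u_m`
(all indices written 0-based, so `(m,k) ≠ (n,1)` becomes `(m,k) ≠ (n−1,0)` and
`e_{m+k−1}` becomes `e_{m+k}`; the sign of `e_{m+k} ∧ e_S = ± e_{S ∪ {m+k}}` is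
`(−1)^{#{x ∈ S : x < m+k}}`). -/
noncomputable def phiMat (n : ℕ) :
    Matrix ({P : Finset (Fin (2 * n - 1)) // P.card = n} × Fin n)
      ({S : Finset (Fin (2 * n - 1)) // S.card = n - 1} × Fin n) ℂ :=
  fun Pm Sk =>
    if (Pm.2 : ℕ) = n - 1 ∧ (Sk.2 : ℕ) = 0 then 0
    else
      if (⟨(Pm.2 : ℕ) + (Sk.2 : ℕ), by
            have := Pm.2.isLt; have := Sk.2.isLt; omega⟩ : Fin (2 * n - 1)) ∈ Sk.1.1 then 0
      else if Pm.1.1 = insert (⟨(Pm.2 : ℕ) + (Sk.2 : ℕ), by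
            have := Pm.2.isLt; have := Sk.2.isLt; omega⟩ : Fin (2 * n - 1)) Sk.1.1 then
        (-1 : ℂ) ^ (Sk.1.1.filter fun x : Fin (2 * n - 1) => (x : ℕ) < (Pm.2 : ℕ) + (Sk.2 : ℕ)).card
      else 0

open Finset in
/-- An element `x` of `s` has as many predecessors in `s` as its index in the increasing
enumeration of `s`. -/
theorem card_filter_lt_orderEmbOfFin {α : Type*} [LinearOrder α] (s : Finset α) {n : ℕ}
    (h : s.card = n) (m : Fin n) : #{y ∈ s | y < s.orderEmbOfFin h m} = m := by
  have : {y ∈ s | y < s.orderEmbOfFin h m} = (Finset.Iio m).map (s.orderEmbOfFin h).toEmbedding := by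
    ext y
    simp only [mem_filter, mem_map, mem_Iio, RelEmbedding.coe_toEmbedding]
    constructor
    · rintro ⟨hy, hlt⟩
      obtain ⟨i, rfl⟩ : y ∈ Set.range (s.orderEmbOfFin h) := by simpa using hy
      exact ⟨i, by simpa using hlt, rfl⟩
    · rintro ⟨i, hi, rfl⟩
      exact ⟨s.orderEmbOfFin_mem h i, by simpa using hi⟩
  rw [this, card_map, Fin.card_Iio]

/-- The element of index `v.2` in the increasing enumeration of `v.1`. -/
def markedElem {N n : ℕ} (v : {P : Finset (Fin N) // P.card = n} × Fin n) : Fin N :=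
  v.1.1.orderEmbOfFin v.1.2 v.2

/-- `ExchangeStep v w`: the marked element of `v` is replaced by another element, and the index
is shifted by the displacement. -/
def ExchangeStep {N n : ℕ} (v w : {P : Finset (Fin N) // P.card = n} × Fin n) : Prop :=
  ∃ q : Fin N, q ≠ markedElem v ∧ q ∉ v.1.1 ∧ w.1.1 = insert q (v.1.1.erase (markedElem v)) ∧
    (q : ℕ) + v.2 = markedElem v + w.2

section Combinatorics

variable {N n : ℕ} {v w : {P : Finset (Fin N) // P.card = n} × Fin n}

theorem markedElem_mem (v : {P : Finset (Fin N) // P.card = n} × Fin n) :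
    markedElem v ∈ v.1.1 :=
  Finset.orderEmbOfFin_mem _ _ _

open Finset in
theorem card_filter_lt_markedElem (v : {P : Finset (Fin N) // P.card = n} × Fin n) :
    #{y ∈ v.1.1 | y < markedElem v} = v.2 :=
  card_filter_lt_orderEmbOfFin _ _ _

open Finset in
theorem index_le_markedElem (v : {P : Finset (Fin N) // P.card = n} × Fin n) :
    (v.2 : ℕ) ≤ markedElem v := by
  rw [← card_filter_lt_markedElem v, ← Fin.card_Iio]
  exact card_le_card fun y hy => by simpa using (mem_filter.1 hy).2

open Finset in
theorem markedElem_add_lt (v : {P : Finset (Fin N) // P.card = n} × Fin n) :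
    (markedElem v : ℕ) + n ≤ v.2 + N := by
  have h₁ := card_filter_lt_markedElem v
  have h₂ := card_filter_add_card_filter_not (s := v.1.1) (fun y => y < markedElem v)
  have h₃ : #{y ∈ v.1.1 | ¬ y < markedElem v} ≤ #(Finset.Ici (markedElem v)) :=
    card_le_card fun y hy => by simpa using (mem_filter.1 hy).2
  rw [Fin.card_Ici] at h₃
  have := v.1.2
  have := (markedElem v).isLt
  omega

open Finset in
/-- An exchange that moves up leaves the new marked element above the inserted one. -/
theorem lt_markedElem_of_exchange {q : Fin N} (hw : w.1.1 = insert q (v.1.1.erase (markedElem v)))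
    (hq : (q : ℕ) + v.2 = markedElem v + w.2) (h : markedElem v < q) : q < markedElem w := by
  by_contra! hle
  have hsub : {y ∈ w.1.1 | y < markedElem w} ⊆
      {y ∈ v.1.1 | y < markedElem v} ∪ Finset.Ioo (markedElem v) q := by
    intro y hy
    simp only [hw, mem_filter, mem_insert, mem_erase, mem_union, mem_Ioo] at hy ⊢
    obtain ⟨rfl | ⟨hne, hy⟩, hlt⟩ := hy
    · exact absurd hlt hle.not_gt
    · rcases lt_or_gt_of_ne hne with h' | h'
      · exact .inl ⟨hy, h'⟩
      · exact .inr ⟨h', hlt.trans_le hle⟩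
  have := (card_le_card hsub).trans (card_union_le _ _)
  rw [card_filter_lt_markedElem, card_filter_lt_markedElem, Fin.card_Ioo] at this
  have : (markedElem v : ℕ) < q := h
  omega

open Finset in
/-- An exchange that moves down leaves the new marked element below the inserted one. -/
theorem markedElem_lt_of_exchange {q : Fin N} (hqv : q ∉ v.1.1)
    (hw : w.1.1 = insert q (v.1.1.erase (markedElem v)))
    (hq : (q : ℕ) + v.2 = markedElem v + w.2) (h : q < markedElem v) : markedElem w < q := by
  by_contra! hle
  have hsub : {y ∈ v.1.1 | y < markedElem v} ⊆
      {y ∈ w.1.1 | y < markedElem w} ∪ Finset.Ioo q (markedElem v) := by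
    intro y hy
    simp only [hw, mem_filter, mem_insert, mem_erase, mem_union, mem_Ioo] at hy ⊢
    obtain ⟨hy, hlt⟩ := hy
    rcases lt_or_gt_of_ne (ne_of_mem_of_not_mem hy hqv) with h' | h'
    · exact .inl ⟨.inr ⟨hlt.ne, hy⟩, h'.trans_le hle⟩
    · exact .inr ⟨h', hlt⟩
  have := (card_le_card hsub).trans (card_union_le _ _)
  rw [card_filter_lt_markedElem, card_filter_lt_markedElem, Fin.card_Ioo] at this
  have : (q : ℕ) < markedElem v := h
  omega

/-- If an exchange inserts `q`, then one of the two marked elements lies above `q`. -/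
theorem ExchangeStep.lt_or_lt (h : ExchangeStep v w) {q : Fin N} (hv : q ∉ v.1.1)
    (hw : q ∈ w.1.1) : q < markedElem v ∨ q < markedElem w := by
  obtain ⟨r, hne, hr, hwr, hidx⟩ := h
  obtain rfl : q = r := by
    rw [hwr, Finset.mem_insert, Finset.mem_erase] at hw
    tauto
  exact (lt_or_gt_of_ne hne).imp_right fun h => lt_markedElem_of_exchange hwr hidx h

theorem ExchangeStep.markedElem_notMem (h : ExchangeStep v w) : markedElem v ∉ w.1.1 := by
  obtain ⟨q, hne, -, hwq, -⟩ := h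
  simp [hwq, hne.symm]

/-- A bounded sequence of natural numbers has an eventual upper bound attained infinitely often. -/
theorem exists_eventually_le_frequently_eq {u : ℕ → ℕ} {b : ℕ} (hb : ∀ i, u i ≤ b) :
    ∃ M k, (∀ i ≥ k, u i ≤ M) ∧ ∀ j, ∃ i ≥ j, u i = M := by
  classical
  have hex : ∃ M, ∃ k, ∀ i ≥ k, u i ≤ M := ⟨b, 0, fun i _ => hb i⟩
  obtain ⟨k, hk⟩ := Nat.find_spec hex
  refine ⟨Nat.find hex, k, hk, fun j => ?_⟩
  by_contra! hne
  have hlt : ∀ i ≥ max j k, u i < Nat.find hex := fun i hi =>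
    lt_of_le_of_ne (hk i (le_of_max_le_right hi)) (hne i (le_of_max_le_left hi))
  have hpos := hlt _ le_rfl
  exact Nat.find_min hex (m := Nat.find hex - 1) (by omega)
    ⟨max j k, fun i hi => Nat.le_sub_one_of_lt (hlt i hi)⟩

/-- There is no infinite sequence of exchanges: the largest element marked infinitely often
could never be inserted again. -/
theorem wellFounded_exchangeStep :
    WellFounded fun w v : {P : Finset (Fin N) // P.card = n} × Fin n => ExchangeStep v w := by
  rw [wellFounded_iff_isEmpty_descending_chain]
  refine ⟨fun ⟨a, ha⟩ => ?_⟩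
  obtain ⟨M, k, hle, hfreq⟩ := exists_eventually_le_frequently_eq
    (u := fun i => (markedElem (a i) : ℕ)) (fun i => (markedElem (a i)).isLt.le)
  obtain ⟨i, hik, hi⟩ := hfreq k
  obtain ⟨j, hij, hj⟩ := hfreq (i + 1)
  have hnot : ∀ l ≥ i + 1, markedElem (a i) ∉ (a l).1.1 := by
    intro l hl
    induction l, hl using Nat.le_induction with
    | base => exact (ha i).markedElem_notMem
    | succ l hl ih =>
      intro hmem
      have h₁ := hle l (by omega)
      have h₂ := hle (l + 1) (by omega)
      rcases (ha l).lt_or_lt ih hmem with h | h <;>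
      · rw [Fin.lt_def] at h
        omega
  refine hnot j hij ?_
  rw [Fin.ext (hi.trans hj.symm)]
  exact markedElem_mem _

end Combinatorics

/-- The index of the basis vector `e_{[n]} ⊗ u_n`. -/
def initialIndex (n : ℕ) (hn : 1 ≤ n) :
    {P : Finset (Fin (2 * n - 1)) // P.card = n} × Fin n :=
  ⟨⟨Finset.univ.filter fun x => (x : ℕ) < n, by simp [Fin.card_filter_val_lt]; omega⟩,
    Fin.rev ⟨0, hn⟩⟩

section Flattening

variable {n : ℕ}

theorem mem_initialIndex (hn : 1 ≤ n) (x : Fin (2 * n - 1)) :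
    x ∈ (initialIndex n hn).1.1 ↔ (x : ℕ) < n := by
  simp [initialIndex]

/-- The nonzero entries of `phiMat n`. -/
theorem phiMat_ne_zero {Pm : {P : Finset (Fin (2 * n - 1)) // P.card = n} × Fin n}
    {Sk : {S : Finset (Fin (2 * n - 1)) // S.card = n - 1} × Fin n} :
    phiMat n Pm Sk ≠ 0 ↔ ¬((Pm.2 : ℕ) = n - 1 ∧ (Sk.2 : ℕ) = 0) ∧
      ∃ q : Fin (2 * n - 1), (q : ℕ) = Pm.2 + Sk.2 ∧ q ∉ Sk.1.1 ∧ Pm.1.1 = insert q Sk.1.1 := by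
  have hlt : (Pm.2 : ℕ) + Sk.2 < 2 * n - 1 := by omega
  have hex : (∃ q : Fin (2 * n - 1), (q : ℕ) = Pm.2 + Sk.2 ∧ q ∉ Sk.1.1 ∧
      Pm.1.1 = insert q Sk.1.1) ↔ (⟨Pm.2 + Sk.2, hlt⟩ : Fin (2 * n - 1)) ∉ Sk.1.1 ∧
        Pm.1.1 = insert (⟨Pm.2 + Sk.2, hlt⟩ : Fin (2 * n - 1)) Sk.1.1 := by
    constructor
    · rintro ⟨q, hq, h⟩
      obtain rfl : q = ⟨Pm.2 + Sk.2, hlt⟩ := Fin.ext hq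
      exact h
    · exact fun h => ⟨_, rfl, h⟩
  rw [hex]
  unfold phiMat
  split_ifs <;> simp_all

theorem phiMat_initialIndex (hn : 1 ≤ n)
    (Sk : {S : Finset (Fin (2 * n - 1)) // S.card = n - 1} × Fin n) :
    phiMat n (initialIndex n hn) Sk = 0 := by
  by_contra h
  obtain ⟨h₁, q, hq, -, hP⟩ := phiMat_ne_zero.1 h
  have hmem := (mem_initialIndex hn q).1 (hP ▸ Finset.mem_insert_self _ _)
  have : ((initialIndex n hn).2 : ℕ) = n - 1 := rfl
  omega

theorem eq_initialIndex (hn : 1 ≤ n) {v : {P : Finset (Fin (2 * n - 1)) // P.card = n} × Fin n}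
    (hv : (v.2 : ℕ) = n - 1) (hx : (markedElem v : ℕ) = n - 1) : v = initialIndex n hn := by
  refine Prod.ext (Subtype.ext ?_) (Fin.ext hv)
  symm
  have hcard := card_filter_lt_markedElem v
  have hsub : (initialIndex n hn).1.1 ⊆ v.1.1 := by
    have hIio : v.1.1.filter (fun y => y < markedElem v) = Finset.Iio (markedElem v) := by
      refine Finset.eq_of_subset_of_card_le (fun y hy => by simpa using (Finset.mem_filter.1 hy).2) ?_
      rw [hcard, Fin.card_Iio, hv, hx]
    intro y hy
    rw [mem_initialIndex] at hy
    rcases eq_or_ne y (markedElem v) with rfl | hne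
    · exact markedElem_mem v
    · have hy' : y ∈ Finset.Iio (markedElem v) := by
        rw [Finset.mem_Iio, Fin.lt_def]
        rw [Ne, Fin.ext_iff] at hne
        omega
      rw [← hIio] at hy'
      exact (Finset.mem_filter.1 hy').1
  exact Finset.eq_of_subset_of_card_le hsub (by rw [v.1.2, (initialIndex n hn).1.2])

/-- The source basis vector `e_{P ∖ x} ⊗ v_k` matched with `e_P ⊗ u_m`, where `x` is the marked
element of `(P, m)` and `m + k - 1 = x`. -/
def matchedIndex (v : {P : Finset (Fin (2 * n - 1)) // P.card = n} × Fin n) :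
    {S : Finset (Fin (2 * n - 1)) // S.card = n - 1} × Fin n :=
  ⟨⟨v.1.1.erase (markedElem v), by rw [Finset.card_erase_of_mem (markedElem_mem v), v.1.2]⟩,
    ⟨markedElem v - v.2, by have := markedElem_add_lt v; omega⟩⟩

theorem phiMat_matchedIndex_ne_zero (hn : 1 ≤ n)
    {v : {P : Finset (Fin (2 * n - 1)) // P.card = n} × Fin n} (hv : v ≠ initialIndex n hn) :
    phiMat n v (matchedIndex v) ≠ 0 := by
  have hle := index_le_markedElem v
  refine phiMat_ne_zero.2 ⟨fun ⟨h₁, h₂⟩ => hv (eq_initialIndex hn h₁ ?_), markedElem v, ?_, ?_, ?_⟩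
  · change (markedElem v : ℕ) - v.2 = 0 at h₂
    omega
  · change (markedElem v : ℕ) = v.2 + (markedElem v - v.2)
    omega
  · simp [matchedIndex]
  · simp [matchedIndex, Finset.insert_erase (markedElem_mem v)]

theorem exchangeStep_of_phiMat_ne_zero
    {v w : {P : Finset (Fin (2 * n - 1)) // P.card = n} × Fin n} (hne : w ≠ v)
    (h : phiMat n w (matchedIndex v) ≠ 0) : ExchangeStep v w := by
  obtain ⟨-, q, hq, hqS, hw⟩ := phiMat_ne_zero.1 h
  have hle := index_le_markedElem v
  change (q : ℕ) = w.2 + (markedElem v - v.2) at hq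
  change q ∉ v.1.1.erase (markedElem v) at hqS
  change w.1.1 = insert q (v.1.1.erase (markedElem v)) at hw
  have hqx : q ≠ markedElem v := by
    rintro rfl
    rw [Finset.insert_erase (markedElem_mem v)] at hw
    exact hne (Prod.ext (Subtype.ext hw) (Fin.ext (by omega)))
  exact ⟨q, hqx, fun hq => hqS (Finset.mem_erase.2 ⟨hqx, hq⟩), hw, by omega⟩

open Matrix in
/-- A functional that vanishes on the image of `phiMat n` is supported on `e_{[n]} ⊗ u_n`. -/
theorem eq_zero_of_transpose_mulVec_eq_zero (hn : 1 ≤ n)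
    {f : {P : Finset (Fin (2 * n - 1)) // P.card = n} × Fin n → ℂ}
    (hf : (phiMat n)ᵀ *ᵥ f = 0) (v : {P : Finset (Fin (2 * n - 1)) // P.card = n} × Fin n)
    (hv : v ≠ initialIndex n hn) : f v = 0 := by
  induction v using wellFounded_exchangeStep.induction with
  | _ v ih =>
    have hsum : ∑ w, phiMat n w (matchedIndex v) * f w = 0 := congrFun hf (matchedIndex v)
    rw [Finset.sum_eq_single v _ (by simp)] at hsum
    · exact (mul_eq_zero.1 hsum).resolve_left (phiMat_matchedIndex_ne_zero hn hv)
    · intro w _ hne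
      by_contra hprod
      obtain ⟨h₁, h₂⟩ := mul_ne_zero_iff.1 hprod
      refine h₂ (ih w (exchangeStep_of_phiMat_ne_zero hne h₁) ?_)
      rintro rfl
      exact h₁ (phiMat_initialIndex hn _)

open Matrix in
theorem card_sub_one_le_rank_phiMat (hn : 1 ≤ n) :
    n * Nat.choose (2 * n - 1) n - 1 ≤ (phiMat n).rank := by
  have hker : LinearMap.ker (phiMat n)ᵀ.mulVecLin ≤
      Submodule.span ℂ {Pi.single (initialIndex n hn) (1 : ℂ)} := by
    intro f hf
    rw [Submodule.mem_span_singleton]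
    refine ⟨f (initialIndex n hn), ?_⟩
    ext v
    rcases eq_or_ne v (initialIndex n hn) with rfl | hv
    · simp
    · simp [hv, eq_zero_of_transpose_mulVec_eq_zero hn hf v hv]
  have h₁ := (Submodule.finrank_mono hker).trans (finrank_span_le_card _)
  have h₂ := LinearMap.finrank_range_add_finrank_ker (phiMat n)ᵀ.mulVecLin
  rw [← Matrix.rank_transpose, Matrix.rank]
  simp only [Set.toFinset_singleton, Finset.card_singleton] at h₁
  simp only [Module.finrank_fintype_fun_eq_card, Fintype.card_prod, Fintype.card_finset_len,
    Fintype.card_fin] at h₂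
  rw [mul_comm]
  omega

end Flattening

/-- The restricted Koszul flattening of the reduced matrix multiplication tensor has rank
`n·C(2n−1, n) − 1`; it is surjective onto the coordinate hyperplane complementary to the
basis vector `e_{[n]} ⊗ u_n`. -/
theorem stmt15 (n : ℕ) (hn : 1 ≤ n) :
    (phiMat n).rank = n * Nat.choose (2 * n - 1) n - 1 ∧
    LinearMap.range (phiMat n).mulVecLin =
      LinearMap.ker (LinearMap.proj
        (⟨⟨Finset.univ.map (Fin.castLEEmb (by omega : n ≤ 2 * n - 1)), by simp⟩,
          ⟨n - 1, by omega⟩⟩)) := by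
  generalize hi₀ : (⟨⟨Finset.univ.map (Fin.castLEEmb _), _⟩, ⟨n - 1, _⟩⟩ :
    {P : Finset (Fin (2 * n - 1)) // P.card = n} × Fin n) = i₀
  have hi₀' : i₀ = initialIndex n hn := by
    rw [← hi₀]
    refine Prod.ext (Subtype.ext (Finset.ext fun x => ?_)) rfl
    simp only [mem_initialIndex, Finset.mem_map, Finset.mem_univ, true_and]
    exact ⟨by rintro ⟨i, rfl⟩; exact i.isLt, fun h => ⟨⟨x, h⟩, rfl⟩⟩
  have hle : LinearMap.range (phiMat n).mulVecLin ≤ LinearMap.ker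
      (LinearMap.proj i₀ : ({P : Finset (Fin (2 * n - 1)) // P.card = n} × Fin n → ℂ) →ₗ[ℂ] ℂ) := by
    rintro _ ⟨g, rfl⟩
    simp [Matrix.mulVec, dotProduct, hi₀', phiMat_initialIndex]
  have hdim : Module.finrank ℂ (LinearMap.ker
      (LinearMap.proj i₀ : ({P : Finset (Fin (2 * n - 1)) // P.card = n} × Fin n → ℂ) →ₗ[ℂ] ℂ)) =
        n * Nat.choose (2 * n - 1) n - 1 := by
    have h := LinearMap.finrank_range_add_finrank_ker
      (LinearMap.proj i₀ : ({P : Finset (Fin (2 * n - 1)) // P.card = n} × Fin n → ℂ) →ₗ[ℂ] ℂ)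
    rw [LinearMap.range_eq_top.2 (LinearMap.proj_surjective i₀), finrank_top] at h
    simp only [Module.finrank_fintype_fun_eq_card, Fintype.card_prod, Fintype.card_finset_len,
      Fintype.card_fin, Module.finrank_self] at h
    rw [mul_comm n (Nat.choose _ n)]
    omega
  have hrank := card_sub_one_le_rank_phiMat hn
  refine ⟨le_antisymm (hdim ▸ Submodule.finrank_mono hle) hrank, ?_⟩
  exact Submodule.eq_of_le_of_finrank_le hle (hdim ▸ hrank)
end
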